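/- arXiv:1204.3784 — 7 statements merged into one kernel-verified Lean document; each statement's English description precedes it below -/
import Mathlib

section
/- Let V ⊆ ℂ be open and let ψ : ℂ × V → ℂ be complex-differentiable in t and twice complex-differentiable in z at every point, solving the heat equation ∂ψ/∂t = (1/2)∂²ψ/∂z² on ℂ × V. Let a, b, c, d ∈ ℂ with ad − bc = 1, let U ⊆ ℂ be open such that ct + d ≠ 0 and (at+b)/(ct+d) ∈ V for all t ∈ U, and let s : U → ℂ be complex-differentiable with s(t)² = 1/(ct+d) for all t ∈ U. Then the function (Γψ)(z,t) = s(t)·exp(−c z²/(2(ct+d)))·ψ(z/(ct+d), (at+b)/(ct+d)) solves the heat equation on ℂ × U. -/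
open Metric

namespace HeatAux

lemma hasDerivAt_of_quadratic {f : ℂ → ℂ} {t m : ℂ} {K ρ : ℝ} (hρ : 0 < ρ)
    (h : ∀ τ ∈ ball t ρ, ‖f τ - f t - m * (τ - t)‖ ≤ K * ‖τ - t‖ ^ 2) : HasDerivAt f m t := by
  rw [hasDerivAt_iff_isLittleO]
  have h1 : (fun τ => f τ - f t - (τ - t) • m) =O[nhds t] fun τ => ‖τ - t‖ ^ 2 := by
    refine Asymptotics.IsBigO.of_bound K ?_
    filter_upwards [ball_mem_nhds t hρ] with τ hτ
    have := h τ hτ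
    rw [smul_eq_mul, mul_comm (τ - t) m]
    simpa using this
  refine h1.trans_isLittleO ?_
  have h2 : (fun x : ℂ => ‖x‖ ^ 2) =o[nhds 0] fun x : ℂ => x := by
    exact Asymptotics.isLittleO_norm_pow_id (by norm_num)
  have h3 : Filter.Tendsto (fun τ : ℂ => τ - t) (nhds t) (nhds 0) := by
    have : ContinuousAt (fun τ : ℂ => τ - t) t := by fun_prop
    simpa [ContinuousAt] using this
  exact h2.comp_tendsto h3

lemma cauchy_bound {f : ℂ → ℂ} {c : ℂ} {R C : ℝ} (n : ℕ) (hR : 0 < R)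
    (hf : DifferentiableOn ℂ f (closedBall c R)) (hC : ∀ z ∈ closedBall c R, ‖f z‖ ≤ C) :
    ‖iteratedDeriv n f c‖ ≤ n.factorial * C / R ^ n := by
  refine Complex.norm_iteratedDeriv_le_of_forall_mem_sphere_norm_le n hR ?_
    fun z hz => hC z (sphere_subset_closedBall hz)
  refine DifferentiableOn.diffContOnCl (hf.mono ?_)
  exact closure_ball_subset_closedBall

lemma taylor_bound {f : ℂ → ℂ} {t : ℂ} {r M : ℝ} (hr : 0 < r)
    (hf : DifferentiableOn ℂ f (ball t r)) (hM : ∀ x ∈ ball t r, ‖f x‖ ≤ M) :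
    ∀ τ ∈ ball t (r / 4), ‖f τ - f t - deriv f t * (τ - t)‖ ≤ (32 * M / r ^ 2) * ‖τ - t‖ ^ 2 := by
  intro τ hτ
  have sub1 : ∀ x ∈ ball t (r / 4), closedBall x (r / 4) ⊆ ball t r := fun x hx y hy => by
    have h1 := mem_ball.1 hx
    have h2 := mem_closedBall.1 hy
    have := dist_triangle y x t
    rw [mem_ball]; linarith
  have hM0 : 0 ≤ M := (norm_nonneg _).trans (hM t (mem_ball_self hr))
  have hd2 : ∀ x ∈ ball t (r / 4), ‖deriv (deriv f) x‖ ≤ 32 * M / r ^ 2 := fun x hx => by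
    have := cauchy_bound 2 (by positivity : 0 < r / 4) (hf.mono (sub1 x hx))
      (fun z hz => hM z (sub1 x hx hz))
    rw [iteratedDeriv_succ, iteratedDeriv_one] at this
    refine this.trans (le_of_eq ?_)
    field_simp
    norm_num [Nat.factorial]
    ring
  have hdd : DifferentiableOn ℂ (deriv f) (ball t r) := hf.deriv isOpen_ball
  have hsub : ball t (r / 4) ⊆ ball t r := ball_subset_ball (by linarith)
  have ht : t ∈ ball t (r / 4) := mem_ball_self (by positivity)
  have hd1 : ∀ x ∈ ball t (r / 4), ‖deriv f x - deriv f t‖ ≤ 32 * M / r ^ 2 * ‖x - t‖ := fun x hx =>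
    Convex.norm_image_sub_le_of_norm_deriv_le
      (fun y hy => hdd.differentiableAt (isOpen_ball.mem_nhds (hsub hy))) hd2
      (convex_ball t (r / 4)) ht hx
  have hseg : closedBall t ‖τ - t‖ ⊆ ball t (r / 4) := by
    apply closedBall_subset_ball
    rw [← dist_eq_norm]; exact hτ
  have key := Convex.norm_image_sub_le_of_norm_hasDerivWithin_le
    (f := fun x => f x - deriv f t * x) (f' := fun x => deriv f x - deriv f t)
    (C := 32 * M / r ^ 2 * ‖τ - t‖) (s := closedBall t ‖τ - t‖) (x := t) (y := τ)
    (fun x hx => by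
      have h1 : HasDerivAt f (deriv f x) x :=
        (hf.differentiableAt (isOpen_ball.mem_nhds (hsub (hseg hx)))).hasDerivAt
      have h2 := h1.sub ((hasDerivAt_id x).const_mul (deriv f t))
      exact (h2.congr_deriv (by simp)).hasDerivWithinAt)
    (fun x hx => (hd1 x (hseg hx)).trans (by
      have : ‖x - t‖ ≤ ‖τ - t‖ := by rw [← dist_eq_norm]; exact hx
      gcongr))
    (convex_closedBall _ _) (mem_closedBall_self (norm_nonneg _))
    (by rw [mem_closedBall, dist_eq_norm])
  calc _ = ‖f τ - deriv f t * τ - (f t - deriv f t * t)‖ := by congr 1; ring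
    _ ≤ _ := key
    _ = _ := by ring

section
variable {V : Set ℂ} {ψ : ℂ → ℂ → ℂ}

lemma bounded_region (hV : IsOpen V)
    (hψt : ∀ z : ℂ, ∀ t ∈ V, DifferentiableAt ℂ (fun s => ψ z s) t)
    (hψz : ∀ t ∈ V, Differentiable ℂ (fun w => ψ w t)) (t₀ : ℂ) (ht₀ : t₀ ∈ V) :
    ∃ z₁ : ℂ, ∃ ε > 0, ∃ r > 0, ∃ M : ℝ, ball t₀ r ⊆ V ∧
      ∀ z ∈ ball z₁ ε, ∀ t ∈ ball t₀ r, ‖ψ z t‖ ≤ M := by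
  obtain ⟨r, hr, hrV⟩ := nhds_basis_closedBall.mem_iff.1 (hV.mem_nhds ht₀)
  let F : ℕ → Set ℂ := fun M => {z | ∀ t ∈ closedBall t₀ r, ‖ψ z t‖ ≤ M}
  have hF : ∀ M, IsClosed (F M) := fun M => by
    have : F M = ⋂ t ∈ closedBall t₀ r, {z | ‖ψ z t‖ ≤ M} := by ext z; simp [F]
    rw [this]
    refine isClosed_biInter fun t ht => ?_
    exact isClosed_le (hψz t (hrV ht)).continuous.norm continuous_const
  have hU : ⋃ M, F M = Set.univ := by
    refine Set.eq_univ_of_forall fun z => ?_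
    have hc : ContinuousOn (fun s => ψ z s) (closedBall t₀ r) := fun t ht =>
      (hψt z t (hrV ht)).continuousAt.continuousWithinAt
    obtain ⟨C, hC⟩ := (isCompact_closedBall t₀ r).exists_bound_of_continuousOn hc
    obtain ⟨N, hN⟩ := exists_nat_ge C
    exact Set.mem_iUnion.2 ⟨N, fun t ht => (hC t ht).trans hN⟩
  obtain ⟨M, z₁, hz₁⟩ := nonempty_interior_of_iUnion_of_closed hF hU
  obtain ⟨ε, hε, hb⟩ := Metric.mem_nhds_iff.1 (mem_interior_iff_mem_nhds.1 hz₁)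
  exact ⟨z₁, ε, hε, r, hr, M, ball_subset_closedBall.trans hrV,
    fun z hz t ht => hb hz t (ball_subset_closedBall ht)⟩

lemma hasDerivAt_h
    (hψt : ∀ z : ℂ, ∀ t ∈ V, DifferentiableAt ℂ (fun s => ψ z s) t)
    (hψz : ∀ t ∈ V, Differentiable ℂ (fun w => ψ w t))
    (hheat : ∀ z : ℂ, ∀ t ∈ V,
      deriv (fun s => ψ z s) t = (1 / 2) * deriv (deriv fun w => ψ w t) z)
    {z₁ t : ℂ} {ε ρ M : ℝ} (hε : 0 < ε) (hρ : 0 < ρ) (hV : ball t ρ ⊆ V)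
    (hM : ∀ z ∈ ball z₁ ε, ∀ t' ∈ ball t ρ, ‖ψ z t'‖ ≤ M) (n : ℕ) :
    HasDerivAt (fun τ => iteratedDeriv n (fun w => ψ w τ) z₁)
      ((1 / 2) * iteratedDeriv (n + 2) (fun w => ψ w t) z₁) t := by
  have htV : t ∈ V := hV (mem_ball_self hρ)
  refine hasDerivAt_of_quadratic (ρ := ρ / 4)
    (K := n.factorial * (32 * M / ρ ^ 2) / (ε / 2) ^ n) (by positivity) fun τ hτ => ?_
  have hτV : τ ∈ V := hV (ball_subset_ball (by linarith) hτ)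
  have hd2 : Differentiable ℂ (deriv (deriv fun w => ψ w t)) :=
    ((hψz t htV).deriv).deriv
  have e1 := (hψz τ hτV).contDiff (n := n)
  have e2 := (hψz t htV).contDiff (n := n)
  have e3 := hd2.contDiff (n := n)
  have hG : Differentiable ℂ (fun z => ψ z τ - ψ z t -
      ((1 / 2) * (τ - t)) * deriv (deriv fun w => ψ w t) z) :=
    ((hψz τ hτV).sub (hψz t htV)).sub (hd2.const_mul _)
  have hsub : closedBall z₁ (ε / 2) ⊆ ball z₁ ε := closedBall_subset_ball (by linarith)
  have key := cauchy_bound (c := z₁) (C := 32 * M / ρ ^ 2 * ‖τ - t‖ ^ 2) n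
    (by positivity : 0 < ε / 2) hG.differentiableOn
    (fun z hz => by
      have := taylor_bound hρ (f := fun s => ψ z s)
        (fun x hx => (hψt z x (hV hx)).differentiableWithinAt) (hM z (hsub hz)) τ hτ
      rw [hheat z t htV] at this
      refine le_trans (le_of_eq ?_) this
      congr 1; ring)
  have hit : iteratedDeriv n (fun z => ψ z τ - ψ z t -
      ((1 / 2) * (τ - t)) * deriv (deriv fun w => ψ w t) z) z₁ =
      iteratedDeriv n (fun w => ψ w τ) z₁ - iteratedDeriv n (fun w => ψ w t) z₁ -
      (1 / 2) * iteratedDeriv (n + 2) (fun w => ψ w t) z₁ * (τ - t) := by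
    rw [iteratedDeriv_fun_sub (e1.contDiffAt.sub e2.contDiffAt)
      ((contDiff_const.mul e3).contDiffAt), iteratedDeriv_fun_sub e1.contDiffAt e2.contDiffAt,
      iteratedDeriv_const_mul_field, iteratedDeriv_succ', iteratedDeriv_succ']
    ring
  rw [hit] at key
  refine key.trans (le_of_eq ?_)
  ring

lemma bound_global (hV : IsOpen V)
    (hψt : ∀ z : ℂ, ∀ t ∈ V, DifferentiableAt ℂ (fun s => ψ z s) t)
    (hψz : ∀ t ∈ V, Differentiable ℂ (fun w => ψ w t))
    (hheat : ∀ z : ℂ, ∀ t ∈ V,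
      deriv (fun s => ψ z s) t = (1 / 2) * deriv (deriv fun w => ψ w t) z)
    (z₀ t₀ : ℂ) (ht₀ : t₀ ∈ V) :
    ∃ ρ > 0, ∃ M : ℝ, ball t₀ ρ ⊆ V ∧ ∀ z ∈ ball z₀ 1, ∀ t ∈ ball t₀ ρ, ‖ψ z t‖ ≤ M := by
  obtain ⟨z₁, ε, hε, r, hr, M, hrV, hM⟩ := bounded_region hV hψt hψz t₀ ht₀
  have hM0 : 0 ≤ M := (norm_nonneg _).trans (hM z₁ (mem_ball_self hε) t₀ (mem_ball_self hr))
  let h : ℕ → ℂ → ℂ := fun n τ => iteratedDeriv n (fun w => ψ w τ) z₁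
  have hh : ∀ n, ∀ t ∈ ball t₀ r, HasDerivAt (h n) ((1 / 2) * h (n + 2) t) t := by
    intro n t ht
    obtain ⟨ρ, hρ, hsub⟩ := Metric.mem_nhds_iff.1 (isOpen_ball.mem_nhds ht)
    exact hasDerivAt_h hψt hψz hheat hε hρ (hsub.trans hrV) (fun z hz t' ht' => hM z hz t' (hsub ht')) n
  have hit : ∀ j k, ∀ t ∈ ball t₀ r, iteratedDeriv k (h j) t = (1 / 2) ^ k * h (j + 2 * k) t := by
    intro j k
    induction k with
    | zero => intro t ht; simp
    | succ k ih =>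
      intro t ht
      rw [iteratedDeriv_succ]
      have : iteratedDeriv k (h j) =ᶠ[nhds t] fun t => (1 / 2) ^ k * h (j + 2 * k) t := by
        filter_upwards [isOpen_ball.mem_nhds ht] with x hx using ih x hx
      rw [this.deriv_eq, ((hh (j + 2 * k) t ht).const_mul _).deriv, pow_succ]
      have e : j + 2 * (k + 1) = j + 2 * k + 2 := by ring
      rw [e]; ring
  let C : ℕ → ℝ := fun j => j.factorial * M / (ε / 2) ^ j
  have hC0 : ∀ j, 0 ≤ C j := fun j => by positivity
  have hC : ∀ j, ∀ t ∈ ball t₀ r, ‖h j t‖ ≤ C j := fun j t ht =>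
    cauchy_bound j (by positivity) (hψz t (hrV ht)).differentiableOn
      (fun z hz => hM z (closedBall_subset_ball (by linarith) hz) t ht)
  have hbd : ∀ j k, ∀ t ∈ ball t₀ (r / 2), ‖h (j + 2 * k) t‖ ≤ k.factorial * C j * (8 / r) ^ k := by
    intro j k t ht
    have hsub : closedBall t (r / 4) ⊆ ball t₀ r := fun y hy => by
      have h1 := mem_ball.1 ht
      have h2 := mem_closedBall.1 hy
      have := dist_triangle y t t₀
      rw [mem_ball]; linarith
    have h1 := cauchy_bound (f := h j) k (by positivity : 0 < r / 4)
      (fun x hx => (hh j x (hsub hx)).differentiableAt.differentiableWithinAt)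
      (fun x hx => hC j x (hsub hx))
    rw [hit j k t (ball_subset_ball (by linarith) ht), norm_mul] at h1
    have h2 : ‖((1 / 2 : ℂ)) ^ k‖ = (1 / 2 : ℝ) ^ k := by simp
    rw [h2] at h1
    have h3 : ‖h (j + 2 * k) t‖ = 2 ^ k * ((1 / 2 : ℝ) ^ k * ‖h (j + 2 * k) t‖) := by
      rw [← mul_assoc, ← mul_pow]; norm_num
    rw [h3]
    refine (mul_le_mul_of_nonneg_left h1 (by positivity)).trans (le_of_eq ?_)
    have h4 : (8 / r) ^ k = 2 ^ k / (r / 4) ^ k := by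
      rw [← div_pow]; congr 1; field_simp; norm_num
    rw [h4]; ring
  let R : ℝ := ‖z₀ - z₁‖ + 1
  have hR : 0 ≤ R := by positivity
  let X : ℝ := R ^ 2 * (8 / r)
  have hX : HasSum (fun k : ℕ => X ^ k / (k.factorial : ℝ)) (Real.exp X) := by
    rw [Real.exp_eq_exp_ℝ]; exact NormedSpace.expSeries_div_hasSum_exp X
  refine ⟨r / 2, by positivity, C 0 * Real.exp X + C 1 * R * Real.exp X,
    (ball_subset_ball (by linarith)).trans hrV, fun z hz t ht => ?_⟩
  have htV : t ∈ V := hrV (ball_subset_ball (by linarith) ht)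
  have hzR : ‖z - z₁‖ ≤ R := by
    have h1 : ‖z - z₀‖ < 1 := by rw [← dist_eq_norm]; exact hz
    have h2 := norm_add_le (z - z₀) (z₀ - z₁)
    rw [sub_add_sub_cancel] at h2
    simp only [R]; linarith
  have hsum := Complex.hasSum_taylorSeries_of_entire (hψz t htV) z₁ z
  set a : ℕ → ℂ := fun n => ((n.factorial : ℂ))⁻¹ • (z - z₁) ^ n •
    iteratedDeriv n (fun w => ψ w t) z₁ with ha
  have hterm : ∀ j k, ‖a (j + 2 * k)‖ ≤ C j * R ^ j * (X ^ k / k.factorial) := by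
    intro j k
    have h1 := hbd j k t ht
    have hf : (k.factorial : ℝ) * k.factorial ≤ (j + 2 * k).factorial := by
      have h2 : k.factorial * k.factorial ≤ (k + k).factorial :=
        Nat.le_of_dvd (Nat.factorial_pos _) (Nat.factorial_mul_factorial_dvd_factorial_add k k)
      have h3 : (k + k).factorial ≤ (j + 2 * k).factorial := Nat.factorial_le (by omega)
      exact_mod_cast h2.trans h3
    have hk : (0 : ℝ) < k.factorial := by exact_mod_cast Nat.factorial_pos k
    have hjk : (0 : ℝ) < (j + 2 * k).factorial := by exact_mod_cast Nat.factorial_pos _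
    have hn : ‖a (j + 2 * k)‖ = ((j + 2 * k).factorial : ℝ)⁻¹ *
        (‖z - z₁‖ ^ (j + 2 * k) * ‖h (j + 2 * k) t‖) := by
      simp only [ha, norm_smul, norm_inv, norm_pow, Complex.norm_natCast, h]
    rw [hn]
    calc _ ≤ ((k.factorial : ℝ) * k.factorial)⁻¹ *
          (R ^ (j + 2 * k) * (k.factorial * C j * (8 / r) ^ k)) := by
          gcongr
      _ = _ := by
          simp only [X, mul_pow, pow_add, pow_mul]
          field_simp
  have b0 : ∀ k, ‖a (2 * k)‖ ≤ C 0 * (X ^ k / k.factorial) := fun k => by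
    have := hterm 0 k
    simpa using this
  have b1 : ∀ k, ‖a (2 * k + 1)‖ ≤ C 1 * R * (X ^ k / k.factorial) := fun k => by
    have := hterm 1 k
    rw [add_comm 1] at this
    simpa using this
  have s0 := hX.mul_left (C 0)
  have s1 := hX.mul_left (C 1 * R)
  have q0 := Summable.of_norm_bounded s0.summable b0
  have q1 := Summable.of_norm_bounded s1.summable b1
  have htot := (q0.hasSum.even_add_odd q1.hasSum).unique hsum
  rw [← htot]
  have n0 := tsum_of_norm_bounded s0 b0
  have n1 := tsum_of_norm_bounded s1 b1
  refine (norm_add_le _ _).trans ?_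
  gcongr

lemma curve (hV : IsOpen V)
    (hψt : ∀ z : ℂ, ∀ t ∈ V, DifferentiableAt ℂ (fun s => ψ z s) t)
    (hψz : ∀ t ∈ V, Differentiable ℂ (fun w => ψ w t))
    (hheat : ∀ z : ℂ, ∀ t ∈ V,
      deriv (fun s => ψ z s) t = (1 / 2) * deriv (deriv fun w => ψ w t) z)
    {p q : ℂ → ℂ} {p' q' u : ℂ} (hp : HasDerivAt p p' u) (hq : HasDerivAt q q' u)
    (hu : q u ∈ V) :
    HasDerivAt (fun x => ψ (p x) (q x)) (deriv (fun w => ψ w (q u)) (p u) * p' +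
      (1 / 2) * deriv (deriv fun w => ψ w (q u)) (p u) * q') u := by
  obtain ⟨ρ, hρ, M, hρV, hM⟩ := bound_global hV hψt hψz hheat (p u) (q u) hu
  set A : ℂ → ℂ := fun w => ψ w (q u) with hA
  have hAd : Differentiable ℂ A := hψz _ hu
  have hB : Differentiable ℂ (deriv (deriv A)) := hAd.deriv.deriv
  have d1 : HasDerivAt (fun x => A (p x)) (deriv A (p u) * p') u :=
    (hAd (p u)).hasDerivAt.comp u hp
  have d2 : HasDerivAt (fun x => deriv (deriv A) (p x)) (deriv (deriv (deriv A)) (p u) * p') u :=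
    (hB (p u)).hasDerivAt.comp u hp
  have d3 := (d2.const_mul (1 / 2)).mul (hq.sub_const (q u))
  have dE : HasDerivAt (fun x => ψ (p x) (q x) - A (p x) -
      (1 / 2) * deriv (deriv A) (p x) * (q x - q u)) 0 u := by
    rw [hasDerivAt_iff_isLittleO]
    have hO : (fun x => ψ (p x) (q x) - A (p x) -
        (1 / 2) * deriv (deriv A) (p x) * (q x - q u)) =O[nhds u] fun x => ‖q x - q u‖ ^ 2 := by
      refine Asymptotics.IsBigO.of_bound (32 * M / ρ ^ 2) ?_
      filter_upwards [hp.continuousAt (ball_mem_nhds (p u) one_pos),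
        hq.continuousAt (ball_mem_nhds (q u) (by positivity : 0 < ρ / 4))] with x hx1 hx2
      have := taylor_bound hρ (f := fun s => ψ (p x) s)
        (fun y hy => (hψt _ y (hρV hy)).differentiableWithinAt) (hM (p x) hx1) (q x) hx2
      rw [hheat _ _ hu] at this
      simpa using this
    have h2 : (fun x : ℂ => ‖x‖ ^ 2) =o[nhds 0] fun x : ℂ => x :=
      Asymptotics.isLittleO_norm_pow_id (by norm_num)
    have h3 : Filter.Tendsto (fun x => q x - q u) (nhds u) (nhds 0) := by
      have : ContinuousAt (fun x => q x - q u) u := hq.continuousAt.sub continuousAt_const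
      simpa [ContinuousAt] using this
    have h4 := hO.trans_isLittleO ((h2.comp_tendsto h3).trans_isBigO hq.isBigO_sub)
    simpa [hA] using h4
  have tot := (d1.add d3).add dE
  refine (tot.congr_deriv ?_).congr_of_eventuallyEq (Filter.Eventually.of_forall fun x => ?_)
  · simp
  · simp

end

end HeatAux


/-- The action of `SL(2,ℂ)` on solutions of the heat equation
`∂ψ/∂t = (1/2)∂²ψ/∂z²`. -/
theorem heat_equation_SL2_action
    (V : Set ℂ) (hV : IsOpen V)
    (ψ : ℂ → ℂ → ℂ)
    (hψt : ∀ z : ℂ, ∀ t ∈ V, DifferentiableAt ℂ (fun s => ψ z s) t)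
    (hψz : ∀ z : ℂ, ∀ t ∈ V, DifferentiableAt ℂ (fun w => ψ w t) z ∧
      DifferentiableAt ℂ (deriv fun w => ψ w t) z)
    (hheat : ∀ z : ℂ, ∀ t ∈ V,
      deriv (fun s => ψ z s) t = (1 / 2) * deriv (deriv fun w => ψ w t) z)
    (a b c d : ℂ) (habcd : a * d - b * c = 1)
    (U : Set ℂ) (hU : IsOpen U)
    (hcd : ∀ t ∈ U, c * t + d ≠ 0)
    (hmap : ∀ t ∈ U, (a * t + b) / (c * t + d) ∈ V)
    (s : ℂ → ℂ) (hs : DifferentiableOn ℂ s U)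
    (hs2 : ∀ t ∈ U, s t ^ 2 = 1 / (c * t + d))
    (Γψ : ℂ → ℂ → ℂ)
    (hΓψ : ∀ z t, Γψ z t =
      s t * Complex.exp (-c * z ^ 2 / (2 * (c * t + d))) *
        ψ (z / (c * t + d)) ((a * t + b) / (c * t + d))) :
    ∀ z : ℂ, ∀ t ∈ U,
      deriv (fun u => Γψ z u) t = (1 / 2) * deriv (deriv fun w => Γψ w t) z := by
  intro z t ht
  have hψz' : ∀ t ∈ V, Differentiable ℂ (fun w => ψ w t) := fun t ht z => (hψz z t ht).1
  have hD := hcd t ht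
  have hsd : HasDerivAt s (deriv s t) t := (hs.differentiableAt (hU.mem_nhds ht)).hasDerivAt
  have hlin : HasDerivAt (fun u => c * u + d) c t := by
    simpa using ((hasDerivAt_id t).const_mul c).add_const d
  have hlin2 : HasDerivAt (fun u => a * u + b) a t := by
    simpa using ((hasDerivAt_id t).const_mul a).add_const b
  have hs' : deriv s t = -c * s t / (2 * (c * t + d)) := by
    have e : (fun u => s u ^ 2) =ᶠ[nhds t] fun u => 1 / (c * u + d) := by
      filter_upwards [hU.mem_nhds ht] with u hu using hs2 u hu
    have h1 := (hsd.pow 2).deriv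
    have h2 := ((hasDerivAt_const t (1 : ℂ)).div hlin hD).deriv
    have h3 := e.deriv_eq
    have h4 : 2 * s t * deriv s t = -c / (c * t + d) ^ 2 := by
      have h1' : deriv (fun u => s u ^ 2) t = 2 * s t * deriv s t := by
        refine Eq.trans h1 ?_
        simp
      have h2' : deriv (fun u => 1 / (c * u + d)) t = -c / (c * t + d) ^ 2 := by
        refine Eq.trans h2 ?_
        simp
      rw [← h1', ← h2', h3]
    have hst := hs2 t ht
    rw [eq_div_iff hD] at hst
    rw [eq_div_iff (pow_ne_zero 2 hD)] at h4
    rw [eq_div_iff (by simpa using hD)]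
    linear_combination s t * h4 - 2 * deriv s t * (c * t + d) * hst
  have hq : HasDerivAt (fun u => (a * u + b) / (c * u + d)) (1 / (c * t + d) ^ 2) t := by
    refine (hlin2.div hlin hD).congr_deriv ?_
    congr 1
    linear_combination habcd
  have hp : HasDerivAt (fun u => z / (c * u + d)) (-(z * c) / (c * t + d) ^ 2) t := by
    refine ((hasDerivAt_const t z).div hlin hD).congr_deriv ?_
    simp
  have hcurve := HeatAux.curve hV hψt hψz' hheat hp hq (hmap t ht)
  have hexpt : HasDerivAt (fun u => Complex.exp (-c * z ^ 2 / (2 * (c * u + d))))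
      (Complex.exp (-c * z ^ 2 / (2 * (c * t + d))) * (c ^ 2 * z ^ 2 / (2 * (c * t + d) ^ 2))) t := by
    have h1 := ((hasDerivAt_const t (-c * z ^ 2)).div (hlin.const_mul 2)
      (by simpa using hD)).cexp
    refine h1.congr_deriv ?_
    simp only [Pi.div_apply]
    congr 1
    field_simp
    ring
  have hT := (hsd.mul hexpt).mul hcurve
  have eT : (fun u => Γψ z u) = fun u => s u * Complex.exp (-c * z ^ 2 / (2 * (c * u + d))) *
        ψ (z / (c * u + d)) ((a * u + b) / (c * u + d)) := funext fun u => hΓψ z u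
  have hTd := (congrArg (fun F => deriv F t) eT).trans hT.deriv
  set A : ℂ → ℂ := fun w => ψ w ((a * t + b) / (c * t + d)) with hA
  have hAd : Differentiable ℂ A := hψz' _ (hmap t ht)
  have hAd' : Differentiable ℂ (deriv A) := hAd.deriv
  set D := c * t + d with hDdef
  have hexpz : ∀ w, HasDerivAt (fun w => Complex.exp (-c * w ^ 2 / (2 * D)))
      (Complex.exp (-c * w ^ 2 / (2 * D)) * (-c * w / D)) w := fun w => by
    have h1 := ((((hasDerivAt_id w).pow 2).const_mul (-c)).div_const (2 * D)).cexp
    refine h1.congr_deriv ?_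
    simp
    field_simp
    try simp
  have hdiv : ∀ w, HasDerivAt (fun w : ℂ => w / D) (1 / D) w := fun w =>
    (hasDerivAt_id w).div_const D
  have hA1 : ∀ w, HasDerivAt (fun w => A (w / D)) (deriv A (w / D) * (1 / D)) w := fun w =>
    HasDerivAt.comp (h₂ := A) w (hAd (w / D)).hasDerivAt (hdiv w)
  have hA2 : ∀ w, HasDerivAt (fun w => deriv A (w / D)) (deriv (deriv A) (w / D) * (1 / D)) w :=
    fun w => HasDerivAt.comp (h₂ := deriv A) w (hAd' (w / D)).hasDerivAt (hdiv w)
  have eZ : (fun w => Γψ w t) = fun w => s t * Complex.exp (-c * w ^ 2 / (2 * D)) * A (w / D) :=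
    funext fun w => hΓψ w t
  have eZ1 : deriv (fun w => Γψ w t) = fun w => s t * Complex.exp (-c * w ^ 2 / (2 * D)) *
      ((-c * w / D) * A (w / D) + deriv A (w / D) * (1 / D)) := by
    funext w
    rw [eZ]
    refine ((((hexpz w).const_mul (s t)).mul (hA1 w)).congr_deriv ?_).deriv
    ring
  have hcw : HasDerivAt (fun w => -c * w / D) (-c / D) z := by
    simpa using ((hasDerivAt_id z).const_mul (-c)).div_const D
  have hZ2 := ((hexpz z).const_mul (s t)).mul
    ((hcw.mul (hA1 z)).add ((hA2 z).mul_const (1 / D)))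
  have hZd := (congrArg (fun F => deriv F z) eZ1).trans hZ2.deriv
  beta_reduce at hTd hZd
  rw [hTd, hZd, hs']
  have hAz : ψ (z / D) ((a * t + b) / D) = A (z / D) := rfl
  simp only [Pi.mul_apply, Pi.add_apply, hAz, ← hDdef]
  generalize Complex.exp (-c * z ^ 2 / (2 * D)) = E
  generalize deriv (deriv A) (z / D) = A2
  generalize deriv A (z / D) = A1
  generalize A (z / D) = A0
  clear_value D
  field_simp
  ring
end

section
/- Let n ≥ 1, δ ∈ {0,1}, c ∈ ℂ, and for k = 2,…,n+1 let p_{k+1} : ℂⁿ → ℂ be a polynomial function of x = (x₂,…,x_{n+1}). Let F : ℂ × ℂⁿ → ℂ be complex-differentiable in each of the variables x_k, twice complex-differentiable in z, and satisfy for all (z,x): (1/2)∂²F/∂z² − (c/(4(1+2δ))) x₂ z² F = Σ_{k=2}^{n+1} p_{k+1}(x) ∂F/∂x_k, and z ∂F/∂z − δF = Σ_{k=2}^{n+1} 2k x_k ∂F/∂x_k. Let V ⊆ ℂ be open and let r, h, x₂,…,x_{n+1} : V → ℂ be complex-differentiable with r' = −(δ + 1/2)h, h' = −h² − (c/(2(1+2δ)))x₂,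 and x_k' = p_{k+1}(x₂,…,x_{n+1}) − 2k h x_k for k = 2,…,n+1. Then ψ(z,t) = exp(−(1/2)h(t)z² + r(t)) · F(z, x₂(t),…,x_{n+1}(t)) solves the heat equation ∂ψ/∂t = (1/2)∂²ψ/∂z² on ℂ × V. -/
section HartogsHelpers

open Metric Set Filter Topology MeasureTheory

lemma hs_deriv_bound {f : ℂ → ℂ} {w : ℂ} {s M : ℝ} (hs : 0 < s)
    (hf : DifferentiableOn ℂ f (ball w s)) (hM : ∀ v ∈ ball w s, ‖f v‖ ≤ M) :
    ∀ v ∈ ball w (s / 2), ‖deriv f v‖ ≤ M / (s / 2) := by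
  intro v hv
  have hsub : closedBall v (s / 2) ⊆ ball w s := by
    intro z hz
    rw [mem_closedBall] at hz
    rw [mem_ball] at hv ⊢
    linarith [dist_triangle z v w]
  apply Complex.norm_deriv_le_of_forall_mem_sphere_norm_le (by linarith)
  · exact (hf.mono hsub).diffContOnCl_ball subset_rfl
  · intro z hz
    exact hM z (hsub (sphere_subset_closedBall hz))

lemma hs_lip {f : ℂ → ℂ} {w : ℂ} {s M : ℝ} (hs : 0 < s)
    (hf : DifferentiableOn ℂ f (ball w s)) (hM : ∀ v ∈ ball w s, ‖f v‖ ≤ M) :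
    ∀ v ∈ ball w (s / 2), ‖f v - f w‖ ≤ M / (s / 2) * ‖v - w‖ := by
  intro v hv
  have hsub : ball w (s / 2) ⊆ ball w s := ball_subset_ball (by linarith)
  apply Convex.norm_image_sub_le_of_norm_deriv_le (s := ball w (s / 2))
    (fun z hz => hf.differentiableAt (isOpen_ball.mem_nhds (hsub hz)))
    (hs_deriv_bound hs hf hM) (convex_ball _ _) (mem_ball_self (by linarith)) hv

lemma hs_taylor {f : ℂ → ℂ} {w : ℂ} {s M : ℝ} (hs : 0 < s)
    (hf : DifferentiableOn ℂ f (ball w s)) (hM : ∀ v ∈ ball w s, ‖f v‖ ≤ M) :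
    ∀ v ∈ ball w (s / 2 / 2), ‖f v - f w - (v - w) * deriv f w‖
      ≤ M / (s / 2) / (s / 2 / 2) * ‖v - w‖ * ‖v - w‖ := by
  intro v hv
  have hsub : ball w (s / 2) ⊆ ball w s := ball_subset_ball (by linarith)
  have hsub2 : ball w (s / 2 / 2) ⊆ ball w s := ball_subset_ball (by linarith)
  have h1 : DifferentiableOn ℂ (deriv f) (ball w (s / 2)) := (hf.deriv isOpen_ball).mono hsub
  have h2 := hs_lip (by linarith) h1 (hs_deriv_bound hs hf hM)
  have hM0 : 0 ≤ M := (norm_nonneg _).trans (hM w (mem_ball_self hs))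
  set C := M / (s / 2) / (s / 2 / 2)
  have hC : 0 ≤ C := by positivity
  have h3 := Convex.norm_image_sub_le_of_norm_hasDerivWithin_le
    (f := fun z => f z - z * deriv f w) (f' := fun z => deriv f z - 1 * deriv f w)
    (s := closedBall w (dist v w)) (x := w) (y := v) (C := C * ‖v - w‖) ?_ ?_
    (convex_closedBall _ _) (mem_closedBall_self dist_nonneg) (by simp)
  · have e : f v - f w - (v - w) * deriv f w =
        (f v - v * deriv f w) - (f w - w * deriv f w) := by ring
    rw [e]
    exact h3
  · intro z hz
    have hz2 : z ∈ ball w (s / 2 / 2) := by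
      rw [mem_closedBall] at hz; rw [mem_ball] at *; linarith
    exact ((hf.differentiableAt (isOpen_ball.mem_nhds (hsub2 hz2))).hasDerivAt.sub
      ((hasDerivAt_id z).mul_const _)).hasDerivWithinAt
  · intro z hz
    have hz2 : z ∈ ball w (s / 2 / 2) := by
      rw [mem_closedBall] at hz; rw [mem_ball] at *; linarith
    rw [one_mul]
    refine (h2 z hz2).trans ?_
    rw [mem_closedBall, dist_eq_norm, dist_eq_norm] at hz
    gcongr

/-- separately holomorphic and locally bounded -/
def HsSH (U W : Set ℂ) (g : ℂ → ℂ → ℂ) : Prop :=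
  (∀ w ∈ W, DifferentiableOn ℂ (fun t => g t w) U) ∧
  (∀ t ∈ U, DifferentiableOn ℂ (g t) W) ∧
  ∀ t ∈ U, ∀ w ∈ W, ∃ s > 0, ∃ M, ball t s ⊆ U ∧ ball w s ⊆ W ∧
    ∀ t' ∈ ball t s, ∀ w' ∈ ball w s, ‖g t' w'‖ ≤ M

lemma HsSH.deriv {U W : Set ℂ} {g : ℂ → ℂ → ℂ} (hg : HsSH U W g) :
    HsSH U W (fun t => deriv (g t)) := by
  obtain ⟨h1, h2, h3⟩ := hg
  refine ⟨?_, ?_, ?_⟩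
  · intro w hw t ht
    obtain ⟨s, hs, M, hU, hW, hM⟩ := h3 t ht w hw
    have hM0 : 0 ≤ M := (norm_nonneg _).trans (hM t (mem_ball_self hs) w (mem_ball_self hs))
    have key : TendstoUniformlyOn (fun (h : ℂ) t' => (g t' (w + h) - g t' w) / h)
        (fun t' => _root_.deriv (g t') w) (𝓝[≠] 0) (ball t s) := by
      rw [Metric.tendstoUniformlyOn_iff]
      intro ε hε
      set C := M / (s / 2) / (s / 2 / 2)
      have hC : 0 ≤ C := by positivity
      have e1 : ∀ᶠ h in 𝓝[≠] (0 : ℂ), h ∈ ball (0 : ℂ) (s / 2 / 2) :=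
        nhdsWithin_le_nhds (ball_mem_nhds _ (by positivity))
      have e2 : ∀ᶠ h in 𝓝[≠] (0 : ℂ), h ∈ ball (0 : ℂ) (ε / (C + 1)) :=
        nhdsWithin_le_nhds (ball_mem_nhds _ (by positivity))
      filter_upwards [e1, e2, self_mem_nhdsWithin] with h hh1 hh2 hh3 t' ht'
      have hne : h ≠ 0 := hh3
      have hn : 0 < ‖h‖ := norm_pos_iff.2 hne
      have := hs_taylor hs ((h2 t' (hU ht')).mono hW) (hM t' ht') (w + h) (by simpa using hh1)
      rw [add_sub_cancel_left] at this
      rw [dist_eq_norm, norm_sub_rev]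
      have e : (g t' (w + h) - g t' w) / h - _root_.deriv (g t') w =
        (g t' (w + h) - g t' w - h * _root_.deriv (g t') w) / h := by field_simp
      rw [e, norm_div, div_lt_iff₀ hn]
      refine this.trans_lt ?_
      apply mul_lt_mul_of_pos_right _ hn
      rw [mem_ball_zero_iff, lt_div_iff₀ (by positivity)] at hh2
      change C * ‖h‖ < ε
      nlinarith
    have hd : ∀ᶠ h in 𝓝[≠] (0 : ℂ), DifferentiableOn ℂ
        (fun t' => (g t' (w + h) - g t' w) / h) (ball t s) := by
      have e1 : ∀ᶠ h in 𝓝[≠] (0 : ℂ), h ∈ ball (0 : ℂ) s :=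
        nhdsWithin_le_nhds (ball_mem_nhds _ (by positivity))
      filter_upwards [e1] with h hh
      exact (((h1 (w + h) (hW (by simpa using hh))).mono hU).sub ((h1 w hw).mono hU)).div_const _
    exact ((key.tendstoLocallyUniformlyOn.differentiableOn hd isOpen_ball).differentiableAt
      (ball_mem_nhds _ hs)).differentiableWithinAt
  · intro t ht w hw
    obtain ⟨s, hs, M, hU, hW, hM⟩ := h3 t ht w hw
    exact ((((h2 t ht).mono hW).deriv isOpen_ball).differentiableAt
      (ball_mem_nhds _ hs)).differentiableWithinAt
  · intro t ht w hw
    obtain ⟨s, hs, M, hU, hW, hM⟩ := h3 t ht w hw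
    have hb : ∀ x : ℂ, ball x (s / 2) ⊆ ball x s := fun x => ball_subset_ball (by linarith)
    exact ⟨s / 2, by linarith, M / (s / 2), (hb t).trans hU, (hb w).trans hW, fun t' ht' =>
      hs_deriv_bound hs ((h2 t' (hU (hb t ht'))).mono hW) (hM t' (hb t ht'))⟩

lemma HsSH.swap {U W : Set ℂ} {g : ℂ → ℂ → ℂ} (hg : HsSH U W g) :
    HsSH W U (fun w t => g t w) := by
  obtain ⟨h1, h2, h3⟩ := hg
  refine ⟨h2, h1, fun w hw t ht => ?_⟩
  obtain ⟨s, hs, M, hU, hW, hM⟩ := h3 t ht w hw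
  exact ⟨s, hs, M, hW, hU, fun w' hw' t' ht' => hM t' ht' w' hw'⟩

lemma HsSH.continuousAt {U W : Set ℂ} {g : ℂ → ℂ → ℂ} (hg : HsSH U W g) {t w : ℂ}
    (ht : t ∈ U) (hw : w ∈ W) : ContinuousAt (fun p : ℂ × ℂ => g p.1 p.2) (t, w) := by
  obtain ⟨h1, h2, h3⟩ := hg
  obtain ⟨s, hs, M, hU, hW, hM⟩ := h3 t ht w hw
  have c1 : ContinuousAt (fun t' => g t' w) t :=
    (((h1 w hw).mono hU).differentiableAt (ball_mem_nhds _ hs)).continuousAt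
  have c2 : Tendsto (fun p : ℂ × ℂ => g p.1 p.2 - g p.1 w) (𝓝 (t, w)) (𝓝 0) := by
    apply squeeze_zero_norm' (a := fun p : ℂ × ℂ => M / (s / 2) * ‖p.2 - w‖)
    · have : ball t s ×ˢ ball w (s / 2) ∈ 𝓝 (t, w) :=
        prod_mem_nhds (ball_mem_nhds _ hs) (ball_mem_nhds _ (by linarith))
      filter_upwards [this] with p hp
      exact hs_lip hs ((h2 p.1 (hU hp.1)).mono hW) (hM p.1 hp.1) p.2 hp.2
    · have : Continuous (fun p : ℂ × ℂ => M / (s / 2) * ‖p.2 - w‖) := by fun_prop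
      simpa using this.tendsto (t, w)
  have c3 : Tendsto (fun p : ℂ × ℂ => g p.1 w) (𝓝 (t, w)) (𝓝 (g t w)) :=
    c1.tendsto.comp (continuous_fst.tendsto (t, w))
  have := c2.add c3
  simpa [ContinuousAt] using this

lemma HsSH.iteratedDeriv {U W : Set ℂ} {g : ℂ → ℂ → ℂ} (hg : HsSH U W g) (k : ℕ) :
    HsSH U W (fun t => iteratedDeriv k (g t)) := by
  induction k with
  | zero => simpa using hg
  | succ k ih => simpa [iteratedDeriv_succ] using ih.deriv

lemma HsSH.chain {U W : Set ℂ} {g : ℂ → ℂ → ℂ} (hU : IsOpen U) (hW : IsOpen W)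
    (hg : HsSH U W g) {x : ℂ → ℂ} {t x' : ℂ} (ht : t ∈ U) (hw : x t ∈ W)
    (hx : HasDerivAt x x' t) :
    HasDerivAt (fun τ => g τ (x τ))
      (_root_.deriv (fun τ => g τ (x t)) t + _root_.deriv (g t) (x t) * x') t := by
  have hnb : U ×ˢ W ∈ 𝓝 (t, x t) := prod_mem_nhds (hU.mem_nhds ht) (hW.mem_nhds hw)
  let T : ℂ →L[ℂ] (ℂ →L[ℂ] ℂ) := ContinuousLinearMap.toSpanSingletonCLE.toContinuousLinearMap
  have hT : ∀ a b, T a b = b * a := fun a b => by simp [T]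
  have key := hasStrictFDerivAt_uncurry_coprod (𝕜 := ℂ) (u := (t, x t)) (f := g)
    (f₁ := fun a b => T (_root_.deriv (fun τ => g τ b) a))
    (f₂ := fun a b => T (_root_.deriv (g a) b)) ?_ ?_ ?_ ?_
  · have h2 : HasDerivAt (fun τ => (τ, x τ)) ((1 : ℂ), x') t := (hasDerivAt_id t).prodMk hx
    have := key.hasFDerivAt.comp_hasDerivAt t h2
    refine this.congr_deriv ?_
    change T _ 1 + T _ x' = _
    rw [hT, hT]
    simp only [one_mul]
    rw [mul_comm x']
  · filter_upwards [hnb] with p hp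
    exact ((hg.1 p.2 hp.2).differentiableAt (hU.mem_nhds hp.1)).hasDerivAt.hasFDerivAt
  · filter_upwards [hnb] with p hp
    exact ((hg.2.1 p.1 hp.1).differentiableAt (hW.mem_nhds hp.2)).hasDerivAt.hasFDerivAt
  · exact T.continuous.continuousAt.comp (hg.swap.deriv.swap.continuousAt ht hw)
  · exact T.continuous.continuousAt.comp (hg.deriv.continuousAt ht hw)

lemma hs_jensen {g : ℂ → ℂ} {t : ℂ} {r : ℝ} (hr : 0 < r)
    (hg : AnalyticOnNhd ℂ g (closedBall t r)) (h0 : g t ≠ 0) :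
    Real.log ‖g t‖ ≤ Real.circleAverage (fun z => Real.log ‖g z‖) t r := by
  have habs : |r| = r := abs_of_pos hr
  have hg' : AnalyticOnNhd ℂ g (closedBall t |r|) := by rwa [habs]
  rw [hg'.circleAverage_log_norm hr.ne' h0]
  have : 0 ≤ ∑ᶠ u, (MeromorphicOn.divisor g (closedBall t |r|) u : ℝ) *
      Real.log (r * ‖t - u‖⁻¹) := by
    apply finsum_nonneg
    intro u
    by_cases hu : u ∈ closedBall t |r|
    · apply mul_nonneg
      · exact_mod_cast (MeromorphicOn.AnalyticOnNhd.divisor_nonneg hg') u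
      · by_cases htu : t = u
        · simp [htu]
        · apply Real.log_nonneg
          have h1 : 0 < ‖t - u‖ := norm_pos_iff.2 (sub_ne_zero.2 htu)
          rw [← div_eq_mul_inv, le_div_iff₀ h1, one_mul]
          rw [habs, mem_closedBall, dist_comm, dist_eq_norm] at hu
          exact hu
    · simp [hu]
  linarith

lemma hs_polar {B : Set ℂ} (hB : MeasurableSet B) {t : ℂ} {ρ : ℝ} (hρ : 0 < ρ)
    (hvol : volume B < ENNReal.ofReal (Real.pi * (ρ ^ 2 / 2))) :
    ∃ r ∈ Ioo 0 ρ, volume {θ | θ ∈ Ioo (-Real.pi) Real.pi ∧ circleMap t r θ ∈ B}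
      ≤ ENNReal.ofReal Real.pi := by
  by_contra! hcon
  apply absurd hvol
  rw [not_lt]
  have h1 : volume B = ∫⁻ p : ℂ, B.indicator 1 (t + p) := by
    rw [lintegral_add_left_eq_self (fun p => B.indicator (1 : ℂ → ENNReal) p) t,
      lintegral_indicator_one hB]
  rw [h1, ← Complex.lintegral_comp_polarCoord_symm]
  have hm : Measurable fun p : ℝ × ℝ => ENNReal.ofReal p.1 •
      B.indicator (1 : ℂ → ENNReal) (t + Complex.polarCoord.symm p) := by
    simp only [Complex.polarCoord_symm_apply, smul_eq_mul]
    apply Measurable.mul (by fun_prop)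
    apply (measurable_one.indicator hB).comp
    fun_prop
  rw [show polarCoord.target = Ioi (0 : ℝ) ×ˢ Ioo (-Real.pi) Real.pi from rfl,
    Measure.volume_eq_prod, setLIntegral_prod _ hm.aemeasurable]
  calc ENNReal.ofReal (Real.pi * (ρ ^ 2 / 2))
      = ∫⁻ r in Ioo 0 ρ, ENNReal.ofReal (r * Real.pi) := by
        rw [← ofReal_integral_eq_lintegral_ofReal]
        · congr 1
          rw [← integral_Ioc_eq_integral_Ioo, ← intervalIntegral.integral_of_le hρ.le,
            intervalIntegral.integral_mul_const, integral_id]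
          ring
        · exact ((continuous_id.mul continuous_const).integrableOn_Icc).mono_set Ioo_subset_Icc_self
        · filter_upwards [ae_restrict_mem measurableSet_Ioo] with r hr
          exact mul_nonneg hr.1.le Real.pi_pos.le
    _ ≤ ∫⁻ r in Ioo 0 ρ, ∫⁻ θ in Ioo (-Real.pi) Real.pi, ENNReal.ofReal r •
          B.indicator (1 : ℂ → ENNReal) (t + Complex.polarCoord.symm (r, θ)) := by
        apply setLIntegral_mono' measurableSet_Ioo
        intro r hr
        have hpre : MeasurableSet {θ | circleMap t r θ ∈ B} :=
          (continuous_circleMap t r).measurable hB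
        have e : ∀ θ : ℝ, B.indicator (1 : ℂ → ENNReal) (t + Complex.polarCoord.symm (r, θ))
            = ({θ | circleMap t r θ ∈ B}).indicator 1 θ := by
          intro θ
          have : t + Complex.polarCoord.symm (r, θ) = circleMap t r θ := by
            simp [circleMap, Complex.exp_mul_I]
          rw [this]
          rfl
        simp_rw [e, smul_eq_mul]
        rw [lintegral_const_mul _ (measurable_one.indicator hpre), lintegral_indicator_one hpre,
          ENNReal.ofReal_mul hr.1.le, Measure.restrict_apply hpre]
        gcongr
        refine (hcon r hr).le.trans (measure_mono ?_)
        intro θ h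
        exact ⟨h.2, h.1⟩
    _ ≤ _ := lintegral_mono_set Ioo_subset_Ioi_self

lemma hs_two_const {B : Set ℂ} (hB : MeasurableSet B) {t : ℂ} {ρ M : ℝ} (hρ : 0 < ρ)
    (hvol : volume B < ENNReal.ofReal (Real.pi * (ρ ^ 2 / 2))) {g : ℂ → ℂ}
    (hg : DifferentiableOn ℂ g (ball t ρ)) (hM1 : 1 ≤ M) (hM : ∀ z ∈ ball t ρ, ‖g z‖ ≤ M)
    (h1 : ∀ z ∈ ball t ρ, z ∉ B → ‖g z‖ ≤ 1) : ‖g t‖ ^ 2 ≤ M := by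
  by_cases h0 : g t = 0
  · rw [h0]; simp; linarith
  obtain ⟨r, ⟨hr0, hrρ⟩, hr⟩ := hs_polar hB (t := t) hρ hvol
  have han : AnalyticOnNhd ℂ g (closedBall t r) :=
    (hg.analyticOnNhd isOpen_ball).mono (closedBall_subset_ball hrρ)
  have hj := hs_jensen hr0 han h0
  have hpre : MeasurableSet {θ | circleMap t r θ ∈ B} :=
    (continuous_circleMap t r).measurable hB
  have hlogM : 0 ≤ Real.log M := Real.log_nonneg hM1
  have hpi := Real.pi_pos
  have hci : CircleIntegrable (fun z => Real.log ‖g z‖) t r := by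
    apply MeromorphicOn.circleIntegrable_log_norm
    rw [abs_of_pos hr0]
    exact han.meromorphicOn.mono_set sphere_subset_closedBall
  have hper : (fun θ => Real.log ‖g (circleMap t r θ)‖).Periodic (2 * Real.pi) :=
    fun θ => by simp [periodic_circleMap t r θ]
  have hav : Real.circleAverage (fun z => Real.log ‖g z‖) t r =
      (2 * Real.pi)⁻¹ * ∫ θ in (-Real.pi)..Real.pi, Real.log ‖g (circleMap t r θ)‖ := by
    have := hper.intervalIntegral_add_eq 0 (-Real.pi)
    rw [zero_add, show -Real.pi + 2 * Real.pi = Real.pi by ring] at this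
    rw [Real.circleAverage_def, this, smul_eq_mul]
  have hii : IntervalIntegrable (fun θ => Real.log ‖g (circleMap t r θ)‖) volume
      (-Real.pi) Real.pi := by
    have := hper.intervalIntegrable₀ (by positivity) hci (-Real.pi) Real.pi
    exact this
  have hle : ∫ θ in (-Real.pi)..Real.pi, Real.log ‖g (circleMap t r θ)‖ ≤
      Real.pi * Real.log M := by
    rw [intervalIntegral.integral_of_le (by linarith), integral_Ioc_eq_integral_Ioo]
    have hi1 : IntegrableOn (fun θ => Real.log ‖g (circleMap t r θ)‖)
        (Ioo (-Real.pi) Real.pi) :=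
      ((intervalIntegrable_iff_integrableOn_Ioo_of_le (by linarith)).1 hii)
    calc ∫ θ in Ioo (-Real.pi) Real.pi, Real.log ‖g (circleMap t r θ)‖
        ≤ ∫ θ in Ioo (-Real.pi) Real.pi,
            ({θ | circleMap t r θ ∈ B}).indicator (fun _ => Real.log M) θ := by
          apply setIntegral_mono hi1
          · exact (integrableOn_const (by simp)).indicator hpre
          intro θ
          have hmem : circleMap t r θ ∈ ball t ρ :=
            sphere_subset_closedBall.trans (closedBall_subset_ball hrρ)
              (circleMap_mem_sphere t hr0.le θ)
          by_cases hθ : circleMap t r θ ∈ B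
          · have : θ ∈ {θ | circleMap t r θ ∈ B} := hθ
            simp only [indicator_of_mem this]
            by_cases hz : g (circleMap t r θ) = 0
            · simp [hz, hlogM]
            · exact Real.log_le_log (norm_pos_iff.2 hz) (hM _ hmem)
          · have : θ ∉ {θ | circleMap t r θ ∈ B} := hθ
            simp only [indicator_of_notMem this]
            exact Real.log_nonpos (norm_nonneg _) (h1 _ hmem hθ)
      _ = volume.real ({θ | circleMap t r θ ∈ B} ∩ Ioo (-Real.pi) Real.pi) * Real.log M := by
          rw [integral_indicator hpre, setIntegral_const, measureReal_restrict_apply hpre,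
            smul_eq_mul]
      _ ≤ Real.pi * Real.log M := by
          gcongr
          rw [inter_comm]
          exact ENNReal.toReal_le_of_le_ofReal hpi.le hr
  rw [hav] at hj
  have hfin : 2 * Real.log ‖g t‖ ≤ Real.log M := by
    have : (2 * Real.pi)⁻¹ * (∫ θ in (-Real.pi)..Real.pi, Real.log ‖g (circleMap t r θ)‖)
        ≤ (2 * Real.pi)⁻¹ * (Real.pi * Real.log M) := by gcongr
    have e : (2 * Real.pi)⁻¹ * (Real.pi * Real.log M) = Real.log M / 2 := by field_simp
    linarith
  have hp : 0 < ‖g t‖ := norm_pos_iff.2 h0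
  rw [← Real.log_le_log_iff (by positivity) (by linarith), Real.log_pow]
  exact_mod_cast hfin

lemma le_of_sq_le_sq_hs {a b : ℝ} (h : a ^ 2 ≤ b ^ 2) (hb : 0 ≤ b) : a ≤ b :=
  (le_abs_self a).trans (abs_le_of_sq_le_sq h hb)

lemma hs_hartogs {U : Set ℂ} (hU : IsOpen U) {g : ℂ → ℂ → ℂ}
    (h1 : ∀ w, DifferentiableOn ℂ (fun t => g t w) U)
    (h2 : ∀ t ∈ U, Differentiable ℂ (g t)) : HsSH U univ g := by
  refine ⟨fun w _ => h1 w, fun t ht => (h2 t ht).differentiableOn, ?_⟩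
  intro t1 ht1 w1 _
  obtain ⟨R, hR, hRU⟩ := Metric.isOpen_iff.1 hU t1 ht1
  obtain ⟨ρ, hρ, hρU⟩ : ∃ ρ > 0, closedBall t1 (2 * ρ) ⊆ U :=
    ⟨R / 4, by linarith, (closedBall_subset_ball (by linarith)).trans hRU⟩
  let E : ℕ → Set ℂ := fun m => {w | ∀ t ∈ closedBall t1 (2 * ρ), ‖g t w‖ ≤ m}
  have hEc : ∀ m, IsClosed (E m) := by
    intro m
    have : E m = ⋂ t ∈ closedBall t1 (2 * ρ), {w | ‖g t w‖ ≤ m} := by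
      ext w; simp [E]
    rw [this]
    exact isClosed_biInter fun t ht =>
      isClosed_le (h2 t (hρU ht)).continuous.norm continuous_const
  have hEu : ⋃ m, E m = univ := by
    rw [eq_univ_iff_forall]
    intro w
    obtain ⟨C, hC⟩ := (isCompact_closedBall t1 (2 * ρ)).exists_bound_of_continuousOn
      ((h1 w).continuousOn.mono hρU)
    obtain ⟨m, hm⟩ := exists_nat_ge C
    exact mem_iUnion.2 ⟨m, fun t ht => (hC t ht).trans hm⟩
  obtain ⟨m, w0, hw0⟩ := nonempty_interior_of_iUnion_of_closed hEc hEu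
  obtain ⟨ε', hε', hεE'⟩ := Metric.isOpen_iff.1 isOpen_interior w0 hw0
  obtain ⟨ε, hε, hε1, hεE⟩ : ∃ ε > 0, ε ≤ 1 ∧ closedBall w0 ε ⊆ E m :=
    ⟨min (ε' / 2) 1, lt_min (by linarith) one_pos, min_le_right _ _,
      (closedBall_subset_ball (lt_of_le_of_lt (min_le_left _ _) (by linarith))).trans
        (hεE'.trans interior_subset)⟩
  set D := ball t1 (2 * ρ) with hD
  have hDU : D ⊆ U := ball_subset_closedBall.trans hρU
  have hbd : ∀ t ∈ D, ∀ w ∈ closedBall w0 ε, ‖g t w‖ ≤ m := fun t ht w hw =>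
    hεE hw t (ball_subset_closedBall ht)
  have hSH : HsSH D (ball w0 ε) g := by
    refine ⟨fun w _ => (h1 w).mono hDU, fun t ht => (h2 t (hDU ht)).differentiableOn, ?_⟩
    intro t ht w hw
    obtain ⟨a, ha, haD⟩ := Metric.isOpen_iff.1 isOpen_ball t ht
    obtain ⟨b, hb, hbD⟩ := Metric.isOpen_iff.1 isOpen_ball w hw
    have hA : ball t (min a b) ⊆ D := (ball_subset_ball (min_le_left _ _)).trans haD
    have hB : ball w (min a b) ⊆ ball w0 ε := (ball_subset_ball (min_le_right _ _)).trans hbD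
    exact ⟨min a b, lt_min ha hb, m, hA, hB, fun t' ht' w' hw' =>
      hbd t' (hA ht') w' (ball_subset_closedBall (hB hw'))⟩
  let A : ℕ → ℂ → ℂ := fun k t => (k.factorial : ℂ)⁻¹ * iteratedDeriv k (g t) w0
  have hAd : ∀ k, DifferentiableOn ℂ (A k) D := fun k =>
    ((hSH.iteratedDeriv k).1 w0 (mem_ball_self hε)).const_mul _
  have hcauchy : ∀ t ∈ D, ∀ S > 0, ∀ C : ℝ, (∀ w ∈ sphere w0 S, ‖g t w‖ ≤ C) → ∀ k,
      ‖A k t‖ * S ^ k ≤ C := by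
    intro t ht S hS C hC k
    have h := Complex.norm_iteratedDeriv_le_of_forall_mem_sphere_norm_le k hS
      (h2 t (hDU ht)).diffContOnCl hC
    have hf : (0 : ℝ) < k.factorial := by exact_mod_cast k.factorial_pos
    rw [le_div_iff₀ (by positivity)] at h
    simp only [A, norm_mul, norm_inv, Complex.norm_natCast]
    rw [mul_assoc, inv_mul_le_iff₀ hf]
    exact h
  obtain ⟨q, hq, hqw⟩ : ∃ q : ℝ, 0 < q ∧ ‖w1 - w0‖ + 1 ≤ q := ⟨‖w1 - w0‖ + 1, by positivity, le_rfl⟩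
  set S : ℝ := (2 * q) ^ 2 / ε with hSdef
  have hS : 0 < S := by positivity
  let B : ℕ → Set ℂ := fun N => {t | t ∈ D ∧ ∃ k, (N : ℝ) < ‖A k t‖ * S ^ k}
  have hBo : ∀ N, IsOpen (B N) := by
    intro N
    have : B N = ⋃ k, D ∩ {t | (N : ℝ) < ‖A k t‖ * S ^ k} := by
      ext t; simp [B]
    rw [this]
    refine isOpen_iUnion fun k => ?_
    exact ((hAd k).continuousOn.norm.mul continuousOn_const).isOpen_inter_preimage
      isOpen_ball isOpen_Ioi
  have hBanti : Antitone B := by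
    intro a b hab t ht
    obtain ⟨h, k, hk⟩ := ht
    exact ⟨h, k, lt_of_le_of_lt (by exact_mod_cast hab) hk⟩
  have hBe : ⋂ N, B N = ∅ := by
    rw [eq_empty_iff_forall_notMem]
    intro t ht
    rw [mem_iInter] at ht
    have htD : t ∈ D := (ht 0).1
    obtain ⟨C, hC⟩ := (isCompact_sphere w0 S).exists_bound_of_continuousOn
      (h2 t (hDU htD)).continuous.continuousOn
    obtain ⟨N, hN⟩ := exists_nat_ge C
    obtain ⟨_, k, hk⟩ := ht N
    exact absurd (hcauchy t htD S hS C hC k) (by linarith)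
  have hlim := tendsto_measure_iInter_atTop (μ := volume)
    (fun N => (hBo N).measurableSet.nullMeasurableSet) hBanti
    ⟨0, ((measure_mono (fun t ht => ht.1 : B 0 ⊆ D)).trans_lt measure_ball_lt_top).ne⟩
  rw [hBe, measure_empty] at hlim
  have hpos : (0 : ENNReal) < ENNReal.ofReal (Real.pi * (ρ ^ 2 / 2)) := by
    rw [ENNReal.ofReal_pos]
    have := Real.pi_pos
    positivity
  obtain ⟨N, hN, hN1⟩ := ((hlim.eventually (gt_mem_nhds hpos)).and (eventually_ge_atTop 1)).exists
  have hN1' : (1 : ℝ) ≤ N := by exact_mod_cast hN1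
  have hN0 : (0 : ℝ) < N := by linarith
  have hcoef : ∀ t ∈ ball t1 ρ, ∀ k, ‖A k t‖ * (2 * q) ^ k ≤ N * (m + 1) := by
    intro t ht k
    have hsub : ball t ρ ⊆ D := by
      intro z hz
      rw [mem_ball] at ht hz
      rw [hD, mem_ball]
      linarith [dist_triangle z t t1]
    set K : ℝ := S ^ k / N with hK
    have hK0 : 0 < K := by positivity
    have hb1 : ∀ z ∈ D, ‖A k z‖ ≤ m / ε ^ k := by
      intro z hz
      rw [le_div_iff₀ (by positivity)]
      exact hcauchy z hz ε hε m (fun w hw => hbd z hz w (sphere_subset_closedBall hw)) k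
    have key := hs_two_const (hBo N).measurableSet (t := t) (M := max 1 (K * (m / ε ^ k))) hρ hN
      (g := fun z => (K : ℂ) * A k z) (((hAd k).mono hsub).const_mul _) (le_max_left _ _) ?_ ?_
    · have hn : ‖(K : ℂ) * A k t‖ = K * ‖A k t‖ := by
        rw [norm_mul, Complex.norm_real, Real.norm_of_nonneg hK0.le]
      simp only [hn] at key
      have hSk : S ^ k * ε ^ k = ((2 * q) ^ k) ^ 2 := by
        rw [← mul_pow, hSdef, div_mul_cancel₀ _ hε.ne', ← pow_mul, ← pow_mul, mul_comm k]
      have ha0 : 0 ≤ ‖A k t‖ := norm_nonneg _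
      have hεk : 0 < ε ^ k := by positivity
      have hSk0 : 0 < S ^ k := by positivity
      have hm0 : (0 : ℝ) ≤ m := Nat.cast_nonneg m
      have hQ0 : 0 < (2 * q) ^ k := by positivity
      have hεQ : ε ^ k ≤ (2 * q) ^ k := by
        apply pow_le_pow_left₀ hε.le
        linarith [norm_nonneg (w1 - w0)]
      have hKN : K * N = S ^ k := by rw [hK]; field_simp
      generalize ‖A k t‖ = a at *
      generalize (2 * q) ^ k = Q at *
      generalize S ^ k = T at *
      generalize ε ^ k = η at *
      rcases le_max_iff.1 key with h | h
      · have h' : K * a ≤ 1 := by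
          have : 0 ≤ K * a := by positivity
          nlinarith
        have hQT : Q ≤ T := by
          by_contra! hc
          nlinarith
        calc a * Q ≤ a * T := by gcongr
          _ = (K * a) * N := by rw [← hKN]; ring
          _ ≤ 1 * N := by gcongr
          _ ≤ N * (m + 1) := by nlinarith
      · rw [mul_pow, pow_two K, mul_assoc] at h
        have h' := le_of_mul_le_mul_left h hK0
        rw [le_div_iff₀ hεk] at h'
        have h'' : (a * Q) ^ 2 ≤ N * m := by
          calc (a * Q) ^ 2 = K * a ^ 2 * η * N := by rw [mul_pow, ← hSk, ← hKN]; ring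
            _ ≤ (m : ℝ) * N := by gcongr
            _ = (N : ℝ) * m := mul_comm _ _
        refine le_of_sq_le_sq_hs ?_ (by positivity)
        refine h''.trans ?_
        have : (1 : ℝ) ≤ N * (m + 1) := by nlinarith
        nlinarith
    · intro z hz
      rw [norm_mul, Complex.norm_real, Real.norm_of_nonneg hK0.le]
      exact le_max_of_le_right (mul_le_mul_of_nonneg_left (hb1 z (hsub hz)) hK0.le)
    · intro z hz hzB
      rw [norm_mul, Complex.norm_real, Real.norm_of_nonneg hK0.le, hK, div_mul_eq_mul_div,
        div_le_one hN0, mul_comm]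
      by_contra! hcon
      exact hzB ⟨hsub hz, k, hcon⟩
  have hmin : ball t1 (min ρ 1) ⊆ ball t1 ρ := ball_subset_ball (min_le_left _ _)
  have hsubD : ball t1 ρ ⊆ D := ball_subset_ball (by linarith)
  refine ⟨min ρ 1, lt_min hρ one_pos, N * (m + 1) * 2,
    (hmin.trans hsubD).trans hDU, subset_univ _, ?_⟩
  intro t ht w hw
  have htD := hsubD (hmin ht)
  have hsum := Complex.hasSum_taylorSeries_of_entire (h2 t (hDU htD)) w0 w
  rw [← hsum.tsum_eq]
  have hgeo : HasSum (fun k : ℕ => (N * (m + 1) : ℝ) * (1 / 2) ^ k) (N * (m + 1) * 2) :=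
    hasSum_geometric_two.mul_left _
  apply tsum_of_norm_bounded hgeo
  intro k
  have hwq : ‖w - w0‖ ≤ q := by
    have : ‖w - w1‖ < 1 := by
      rw [← dist_eq_norm]
      exact lt_of_lt_of_le (mem_ball.1 hw) (min_le_right _ _)
    have h3 : w - w0 = (w - w1) + (w1 - w0) := by ring
    rw [h3]
    linarith [norm_add_le (w - w1) (w1 - w0)]
  have e : ((k.factorial : ℂ)⁻¹ • (w - w0) ^ k • iteratedDeriv k (g t) w0) =
      A k t * (w - w0) ^ k := by
    simp only [A, smul_eq_mul]; ring
  rw [e, norm_mul, norm_pow]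
  calc ‖A k t‖ * ‖w - w0‖ ^ k ≤ ‖A k t‖ * q ^ k := by gcongr
    _ = ‖A k t‖ * (2 * q) ^ k * (1 / 2) ^ k := by
        rw [mul_assoc, ← mul_pow]; congr 2; ring
    _ ≤ _ := by
        exact mul_le_mul_of_nonneg_right (hcoef t (hmin ht) k) (by positivity)

lemma hs_total {n : ℕ} {G : (Fin n → ℂ) → ℂ}
    (hG : ∀ (y : Fin n → ℂ) (i : Fin n),
      DifferentiableAt ℂ (fun w => G (Function.update y i w)) (y i))
    {V : Set ℂ} (hV : IsOpen V) {x : Fin n → ℂ → ℂ} (hx : ∀ i, DifferentiableOn ℂ (x i) V)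
    (s : Finset (Fin n)) : ∀ y : Fin n → ℂ, ∀ t ∈ V,
    HasDerivAt (fun τ => G (fun j => if j ∈ s then x j τ else y j))
      (∑ i ∈ s, deriv (fun w => G (Function.update (fun j => if j ∈ s then x j t else y j) i w))
        (x i t) * deriv (x i) t) t := by
  induction s using Finset.induction_on with
  | empty => intro y t _; simpa using hasDerivAt_const t (G fun j => y j)
  | insert i s hi ih =>
    intro y t ht
    have e1 : ∀ w τ, (fun j => if j ∈ s then x j τ else Function.update y i w j) =
        Function.update (fun j => if j ∈ s then x j τ else y j) i w := by
      intro w τ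
      funext j
      by_cases hj : j = i
      · subst hj; simp [hi]
      · simp [Function.update_of_ne hj]
    have e2 : ∀ τ, (fun j => if j ∈ insert i s then x j τ else y j) =
        Function.update (fun j => if j ∈ s then x j τ else y j) i (x i τ) := by
      intro τ
      funext j
      by_cases hj : j = i
      · subst hj; simp
      · simp [hj]
    let g : ℂ → ℂ → ℂ := fun τ w => G (fun j => if j ∈ s then x j τ else Function.update y i w j)
    have hg : HsSH V univ g := by
      apply hs_hartogs hV
      · intro w τ hτ
        exact (ih (Function.update y i w) τ hτ).differentiableAt.differentiableWithinAt
      · intro τ _ w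
        have := hG (Function.update (fun j => if j ∈ s then x j τ else y j) i w) i
        simp only [Function.update_idem, Function.update_self] at this
        simpa only [g, e1] using this
    have hc := hg.chain hV isOpen_univ ht (mem_univ (x i t))
      (((hx i).differentiableAt (hV.mem_nhds ht)).hasDerivAt)
    have e3 : (fun τ => G (fun j => if j ∈ insert i s then x j τ else y j)) =
        fun τ => g τ (x i τ) := by
      funext τ
      simp only [g, e1, e2]
    rw [e3]
    refine hc.congr_deriv ?_
    rw [Finset.sum_insert hi, add_comm]
    congr 1
    · simp only [g, e1, e2, Function.update_idem]
    · rw [(ih (Function.update y i (x i t)) t ht).deriv]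
      simp only [e1, e2]

end HartogsHelpers

/-- Key theorem (1)+(2)⇒(3) direction ingredient: if `F(z,x)` satisfies the
stationary equation `(1/2)∂²F/∂z² - (c/(4(1+2δ)))x₂z²F = Σ p_{k+1}(x)∂F/∂x_k`
and the Euler homogeneity relation, and `(r,h,x)` solves the associated
homogeneous polynomial dynamical system, then
`ψ(z,t) = exp(-(1/2)h(t)z² + r(t)) F(z,x(t))` solves the heat equation.
Here the index `i : Fin n` stands for `k = i + 2`, so `x i = x_{i+2}` and
`p i = p_{i+3}`. -/
theorem heat_solution_from_dynamical_system
    (n : ℕ) (hn : 1 ≤ n) (δ : ℕ) (hδ : δ = 0 ∨ δ = 1) (c : ℂ)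
    (p : Fin n → (Fin n → ℂ) → ℂ)
    (hpoly : ∀ i, ∃ P : MvPolynomial (Fin n) ℂ, ∀ x, p i x = MvPolynomial.eval x P)
    (F : ℂ → (Fin n → ℂ) → ℂ)
    (hFx : ∀ (z : ℂ) (x : Fin n → ℂ) (i : Fin n),
      DifferentiableAt ℂ (fun w => F z (Function.update x i w)) (x i))
    (hFz : ∀ (z : ℂ) (x : Fin n → ℂ), DifferentiableAt ℂ (fun w => F w x) z ∧
      DifferentiableAt ℂ (deriv fun w => F w x) z)
    (hPDE : ∀ (z : ℂ) (x : Fin n → ℂ),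
      (1 / 2) * deriv (deriv fun w => F w x) z
          - (c / (4 * (1 + 2 * (δ : ℂ)))) * x ⟨0, hn⟩ * z ^ 2 * F z x
        = ∑ i : Fin n, p i x * deriv (fun w => F z (Function.update x i w)) (x i))
    (hEuler : ∀ (z : ℂ) (x : Fin n → ℂ),
      z * deriv (fun w => F w x) z - (δ : ℂ) * F z x
        = ∑ i : Fin n, 2 * ((i : ℕ) + 2) * x i *
            deriv (fun w => F z (Function.update x i w)) (x i))
    (V : Set ℂ) (hV : IsOpen V)
    (r h : ℂ → ℂ) (x : Fin n → ℂ → ℂ)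
    (hr : DifferentiableOn ℂ r V) (hh : DifferentiableOn ℂ h V)
    (hx : ∀ i, DifferentiableOn ℂ (x i) V)
    (hsysr : ∀ t ∈ V, deriv r t = -((δ : ℂ) + 1 / 2) * h t)
    (hsysh : ∀ t ∈ V, deriv h t = -(h t) ^ 2 - (c / (2 * (1 + 2 * (δ : ℂ)))) * x ⟨0, hn⟩ t)
    (hsysx : ∀ i, ∀ t ∈ V,
      deriv (x i) t = p i (fun j => x j t) - 2 * ((i : ℕ) + 2) * h t * x i t)
    (ψ : ℂ → ℂ → ℂ)
    (hψ : ∀ z t, ψ z t = Complex.exp (-(1 / 2) * h t * z ^ 2 + r t) *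
      F z (fun j => x j t)) :
    ∀ z : ℂ, ∀ t ∈ V,
      deriv (fun v => ψ z v) t = (1 / 2) * deriv (deriv fun w => ψ w t) z := by
  intro z t ht
  have hrt := (hr.differentiableAt (hV.mem_nhds ht)).hasDerivAt
  have hht := (hh.differentiableAt (hV.mem_nhds ht)).hasDerivAt
  have hF := hs_total (hFx z) hV hx Finset.univ (fun _ => 0) t ht
  simp only [Finset.mem_univ, if_true] at hF
  have hE := hEuler z (fun j => x j t)
  have hP := hPDE z (fun j => x j t)
  have hsum : ∑ i, deriv (fun w => F z (Function.update (fun j => x j t) i w)) (x i t) *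
      deriv (x i) t =
      ((1 / 2) * deriv (deriv fun w => F w (fun j => x j t)) z
          - (c / (4 * (1 + 2 * (δ : ℂ)))) * x ⟨0, hn⟩ t * z ^ 2 * F z (fun j => x j t))
      - h t * (z * deriv (fun w => F w (fun j => x j t)) z - (δ : ℂ) * F z (fun j => x j t)) := by
    rw [hP, hE, Finset.mul_sum, ← Finset.sum_sub_distrib]
    refine Finset.sum_congr rfl fun i _ => ?_
    rw [hsysx i t ht]
    ring
  rw [hsum] at hF
  rw [hsysr t ht] at hrt
  rw [hsysh t ht] at hht
  have hL := ((((hht.const_mul (-(1 / 2) : ℂ)).mul_const (z ^ 2)).add hrt).cexp).mul hF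
  have hLe : (fun v => ψ z v) = fun v => Complex.exp (-(1 / 2) * h v * z ^ 2 + r v) *
      F z (fun j => x j v) := by funext v; exact hψ z v
  rw [hLe]
  refine hL.deriv.trans ?_
  set f : ℂ → ℂ := fun w => F w (fun j => x j t) with hf
  have hRe : (fun w => ψ w t) = fun w => Complex.exp (-(1 / 2) * h t * w ^ 2 + r t) * f w := by
    funext w; exact hψ w t
  have hexp : ∀ w : ℂ, HasDerivAt (fun w => Complex.exp (-(1 / 2) * h t * w ^ 2 + r t))
      (Complex.exp (-(1 / 2) * h t * w ^ 2 + r t) * (-(h t) * w)) w := by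
    intro w
    have := (((hasDerivAt_pow 2 w).const_mul (-(1 / 2) * h t)).add_const (r t)).cexp
    refine this.congr_deriv ?_
    push_cast
    ring
  have hf1 : ∀ w, HasDerivAt f (deriv f w) w := fun w => (hFz w (fun j => x j t)).1.hasDerivAt
  have hf2 : HasDerivAt (deriv f) (deriv (deriv f) z) z := (hFz z (fun j => x j t)).2.hasDerivAt
  have hd1 : deriv (fun w => Complex.exp (-(1 / 2) * h t * w ^ 2 + r t) * f w) = fun w =>
      Complex.exp (-(1 / 2) * h t * w ^ 2 + r t) * (-(h t) * w) * f w +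
      Complex.exp (-(1 / 2) * h t * w ^ 2 + r t) * deriv f w := by
    funext w
    exact ((hexp w).mul (hf1 w)).deriv
  rw [hRe, hd1]
  have hd2 := (((hexp z).mul ((hasDerivAt_id z).const_mul (-(h t)))).mul (hf1 z)).add
    ((hexp z).mul hf2)
  have hd3 := hd2.deriv
  refine Eq.trans ?_ (congrArg (fun a => (1 / 2 : ℂ) * a) hd3.symm)
  have hδ0 : (1 + 2 * (δ : ℂ)) ≠ 0 := by
    rcases hδ with rfl | rfl <;> norm_num
  simp only [Pi.mul_apply, id]
  have hfz : F z (fun j => x j t) = f z := rfl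
  rw [hfz]
  generalize Complex.exp (-(1 / 2) * h t * z ^ 2 + r t) = e
  field_simp
  ring
end

section
/- Let n ≥ 1, δ ∈ {0,1}, c ∈ ℂ, and for k = 2,…,n+1 let p_{k+1} : ℂⁿ → ℂ be a polynomial function of x = (x₂,…,x_{n+1}). Let Φ : ℂ × ℂⁿ → ℂ be complex-differentiable in each variable (twice in the first), satisfy for all (z,x): (1/2)∂²Φ/∂z² − (c/(4(1+2δ))) x₂ z² Φ = Σ_{k=2}^{n+1} p_{k+1}(x) ∂Φ/∂x_k and z ∂Φ/∂z − δΦ = Σ_{k=2}^{n+1} 2k x_k ∂Φ/∂x_k, and be non-degenerate in the sense that for every map g : ℂⁿ → ℂⁿ, if Σ_{k=2}^{n+1} g_k(x) ∂Φ/∂x_k(z,x) = 0 for all (z,x) then g ≡ 0. Let V ⊆ ℂ be open, h : V → ℂ complex-differentiable, x = (x₂,…,x_{n+1}) : V → ℂⁿ complex-differentiable, and set φ(z,t) = Φ(z, x(t)). Then φ satisfies ∂φ/∂t = (1/2)∂²φ/∂z² − (c/(4(1+2δ))) x₂(t) z² φ − h(t)(z ∂φ/∂z − δφ) on ℂ ×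 V if and only if x_k'(t) = p_{k+1}(x(t)) − 2k h(t) x_k(t) for all k = 2,…,n+1 and all t ∈ V. -/
section Hartogs
open Metric Set MeasureTheory Filter Topology

lemma hart_submean {f : ℂ → ℂ} {c : ℂ} {R : ℝ} (hR : 0 < R)
    (hf : AnalyticOnNhd ℂ f (closedBall c R)) (h0 : f c ≠ 0) :
    Real.log ‖f c‖ ≤ Real.circleAverage (fun z => Real.log ‖f z‖) c R := by
  have hf' : AnalyticOnNhd ℂ f (closedBall c |R|) := by rwa [abs_of_pos hR]
  rw [hf'.circleAverage_log_norm hR.ne' h0]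
  have : 0 ≤ ∑ᶠ u, (MeromorphicOn.divisor f (closedBall c |R|) u : ℝ)
      * Real.log (R * ‖c - u‖⁻¹) := by
    apply finsum_nonneg
    intro u
    by_cases hu : u ∈ closedBall c |R|
    · have h1 : (0:ℝ) ≤ (MeromorphicOn.divisor f (closedBall c |R|) u : ℝ) := by
        exact_mod_cast MeromorphicOn.AnalyticOnNhd.divisor_nonneg hf' u
      refine mul_nonneg h1 ?_
      rcases eq_or_ne c u with rfl | hne
      · simp
      · apply Real.log_nonneg
        have h2 : 0 < ‖c - u‖ := norm_pos_iff.2 (sub_ne_zero.2 hne)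
        rw [← div_eq_mul_inv, le_div_iff₀ h2, one_mul, ← dist_eq_norm, dist_comm]
        simpa [abs_of_pos hR] using hu
    · simp [Function.locallyFinsuppWithin.apply_eq_zero_of_notMem _ hu]
  linarith

lemma hart_radius {B : Set ℂ} (hB : MeasurableSet B) {c : ℂ} {R : ℝ} (hR : 0 < R)
    (hvol : volume (B ∩ ball c R) < ENNReal.ofReal (Real.pi * R ^ 2 / 2)) :
    ∃ r ∈ Ioo 0 R, volume {θ ∈ Ioo (-Real.pi) Real.pi | circleMap c r θ ∈ B}
      ≤ ENNReal.ofReal Real.pi := by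
  by_contra! hcon
  apply absurd hvol
  rw [not_lt]
  have hm : MeasurableSet {q : ℝ × ℝ | circleMap c q.1 q.2 ∈ B} := by
    have : Measurable (fun q : ℝ × ℝ => circleMap c q.1 q.2) := by
      unfold circleMap; fun_prop
    exact this hB
  have e1 : volume (B ∩ ball c R) =
      ∫⁻ w : ℂ, (B ∩ ball c R).indicator (fun _ => (1 : ENNReal)) (w + c) := by
    rw [lintegral_add_right_eq_self (μ := (volume : Measure ℂ))
      (fun w => (B ∩ ball c R).indicator (fun _ => (1 : ENNReal)) w) c]
    rw [lintegral_indicator (hB.inter measurableSet_ball)]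
    simp
  rw [e1, ← Complex.lintegral_comp_polarCoord_symm, polarCoord_target, 
    Measure.volume_eq_prod, ← Measure.prod_restrict, lintegral_prod]
  swap
  · apply Measurable.aemeasurable
    simp only [smul_eq_mul]
    refine Measurable.mul (by fun_prop) ?_
    apply (measurable_const.indicator (hB.inter measurableSet_ball)).comp
    simp only [Complex.polarCoord_symm_apply]
    fun_prop
  calc ENNReal.ofReal (Real.pi * R ^ 2 / 2) 
      = ∫⁻ r in Ioo 0 R, ENNReal.ofReal (r * Real.pi) := by
        rw [← ofReal_integral_eq_lintegral_ofReal]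
        · rw [← integral_Ioc_eq_integral_Ioo, ← intervalIntegral.integral_of_le hR.le]
          simp
          congr 1; ring
        · exact (Continuous.integrableOn_Icc (by fun_prop)).mono_set Ioo_subset_Icc_self
        · filter_upwards [ae_restrict_mem measurableSet_Ioo] with r hr
          exact mul_nonneg hr.1.le Real.pi_pos.le
    _ ≤ ∫⁻ r in Ioo 0 R, _ := by
        refine setLIntegral_mono' measurableSet_Ioo ?_
        · intro r hr
          have h1 := (hcon r hr).le
          have h2 : volume {θ ∈ Ioo (-Real.pi) Real.pi | circleMap c r θ ∈ B} 
            = ∫⁻ θ in Ioo (-Real.pi) Real.pi, 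
              (B ∩ ball c R).indicator (fun _ => (1 : ENNReal)) 
                (Complex.polarCoord.symm (r, θ) + c) := by
            have h3 : MeasurableSet {θ | circleMap c r θ ∈ B} := 
              (continuous_circleMap c r).measurable hB
            rw [← Measure.restrict_apply_univ]
            rw [show {θ | θ ∈ Ioo (-Real.pi) Real.pi ∧ circleMap c r θ ∈ B} = 
              {θ | circleMap c r θ ∈ B} ∩ Ioo (-Real.pi) Real.pi from by ext; simp [and_comm]]
            rw [Measure.restrict_apply_univ, ← Measure.restrict_apply h3,
              ← lintegral_indicator_one h3]
            congr 1
            ext θ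
            have h4 : Complex.polarCoord.symm (r, θ) + c = circleMap c r θ := by
              simp [circleMap, Complex.exp_mul_I, add_comm]
            rw [h4]
            have h5 : circleMap c r θ ∈ ball c R := by
              simp [circleMap, abs_of_pos hr.1, hr.2]
            by_cases h6 : circleMap c r θ ∈ B <;> simp [indicator, h6, h5]
          rw [ENNReal.ofReal_mul hr.1.le]
          refine (mul_le_mul_right h1 _).trans ?_
          rw [h2, ← lintegral_const_mul']
          simp only [smul_eq_mul]
          · exact le_refl _
          · exact ENNReal.ofReal_ne_top
    _ ≤ _ := lintegral_mono_set Ioo_subset_Ioi_self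

lemma hart_two {f : ℂ → ℂ} {c : ℂ} {R F : ℝ} (hR : 0 < R) {B : Set ℂ} (hB : MeasurableSet B)
    (hf : AnalyticOnNhd ℂ f (closedBall c R)) (hF : 1 ≤ F)
    (h1 : ∀ z ∈ closedBall c R, ‖f z‖ ≤ F) (h2 : ∀ z ∈ closedBall c R, z ∉ B → ‖f z‖ ≤ 1)
    (hvol : volume (B ∩ ball c R) < ENNReal.ofReal (Real.pi * R ^ 2 / 2)) :
    ‖f c‖ ^ 2 ≤ F := by
  by_cases h0 : f c = 0
  · simp [h0]; linarith
  obtain ⟨r, hr, hm⟩ := hart_radius hB hR hvol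
  have hsub : closedBall c r ⊆ closedBall c R := closedBall_subset_closedBall hr.2.le
  have hs := hart_submean hr.1 (hf.mono hsub) h0
  have hmB : MeasurableSet {θ | circleMap c r θ ∈ B} := (continuous_circleMap c r).measurable hB
  have hle : Real.circleAverage (fun z => Real.log ‖f z‖) c r ≤
      Real.circleAverage (B.indicator fun _ => Real.log F) c r := by
    apply Real.circleAverage_mono
    · apply MeromorphicOn.circleIntegrable_log_norm
      rw [abs_of_pos hr.1]
      exact (hf.mono (sphere_subset_closedBall.trans hsub)).meromorphicOn
    · have : (fun θ => (B.indicator fun _ => Real.log F) (circleMap c r θ)) =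
        {θ | circleMap c r θ ∈ B}.indicator fun _ => Real.log F := rfl
      unfold CircleIntegrable
      rw [this, intervalIntegrable_iff]
      exact IntegrableOn.indicator (by
        exact integrableOn_const (by simp [ENNReal.mul_eq_top])) hmB
    · intro z hz
      rw [abs_of_pos hr.1] at hz
      have hz' := hsub (sphere_subset_closedBall hz)
      rcases eq_or_ne (f z) 0 with h | h
      · simp only [h, norm_zero, Real.log_zero]
        exact indicator_nonneg (fun _ _ => Real.log_nonneg hF) _
      by_cases hzB : z ∈ B
      · simp only [hzB, indicator_of_mem]
        exact Real.log_le_log (norm_pos_iff.2 h) (h1 z hz')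
      · simp only [hzB, not_false_eq_true, indicator_of_notMem]
        exact Real.log_nonpos (norm_nonneg _) (h2 z hz' hzB)
  have hval : Real.circleAverage (B.indicator fun _ => Real.log F) c r ≤ Real.log F / 2 := by
    rw [Real.circleAverage_eq_integral_add (-Real.pi)]
    rw [intervalIntegral.integral_comp_add_right (fun θ => (B.indicator fun _ => Real.log F) (circleMap c r θ))]
    rw [intervalIntegral.integral_of_le (by linarith [Real.pi_pos]), integral_Ioc_eq_integral_Ioo]
    have : (fun θ => (B.indicator fun _ => Real.log F) (circleMap c r θ)) =
        {θ | circleMap c r θ ∈ B}.indicator fun _ => Real.log F := rfl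
    rw [this, integral_indicator hmB, Measure.restrict_restrict hmB, setIntegral_const]
    have hm2 : volume.real ({θ | circleMap c r θ ∈ B} ∩ Ioo (0 + -Real.pi) (2 * Real.pi + -Real.pi))
        ≤ Real.pi := by
      rw [Measure.real]
      apply ENNReal.toReal_le_of_le_ofReal Real.pi_pos.le
      convert hm using 2
      ext θ
      simp only [mem_inter_iff, mem_ofPred_eq, zero_add]
      rw [show 2 * Real.pi + -Real.pi = Real.pi by ring, and_comm]
    simp only [smul_eq_mul]
    rw [inv_mul_le_iff₀ (by positivity)]
    calc _ ≤ Real.pi * Real.log F := mul_le_mul_of_nonneg_right hm2 (Real.log_nonneg hF)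
      _ = _ := by ring
  have hfin : Real.log (‖f c‖ ^ 2) ≤ Real.log F := by
    rw [Real.log_pow]; push_cast; linarith
  exact (Real.log_le_log_iff (by positivity) (by linarith)).1 hfin

lemma hart_param {H : ℂ → ℝ → ℂ} {t0 : ℂ} {R M : ℝ}
    (hc : ∀ t ∈ ball t0 R, Continuous (H t))
    (hd : ∀ θ, DifferentiableOn ℂ (fun t => H t θ) (ball t0 R))
    (hM : ∀ t ∈ ball t0 R, ∀ θ, ‖H t θ‖ ≤ M) :
    DifferentiableOn ℂ (fun t => ∫ θ in (0:ℝ)..(2 * Real.pi), H t θ) (ball t0 R) := by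
  intro y hy
  obtain ⟨ρ, hρ, hsub⟩ : ∃ ρ > 0, ball y (2 * ρ) ⊆ ball t0 R := by
    obtain ⟨ε, hε, h⟩ := Metric.isOpen_iff.1 isOpen_ball y hy
    exact ⟨ε / 2, by positivity, by rwa [mul_div_cancel₀ _ two_ne_zero]⟩
  have hda : ∀ θ, ∀ x ∈ ball y ρ, HasDerivAt (fun t => H t θ) (deriv (fun t => H t θ) x) x := by
    intro θ x hx
    apply DifferentiableAt.hasDerivAt
    apply (hd θ).differentiableAt
    exact isOpen_ball.mem_nhds (hsub (ball_subset_ball (by linarith) hx))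
  have key := intervalIntegral.hasDerivAt_integral_of_dominated_loc_of_deriv_le (μ := volume)
    (a := 0) (b := 2 * Real.pi) (F := H) (F' := fun x θ => deriv (fun t => H t θ) x) (x₀ := y)
    (s := ball y ρ) (bound := fun _ => M / ρ) (ball_mem_nhds y hρ)
    (by
      filter_upwards [isOpen_ball.mem_nhds hy] with t ht
      exact (hc t ht).aestronglyMeasurable)
    ((hc y hy).intervalIntegrable _ _)
    (by
      have hseq : Tendsto (fun n : ℕ => y + ((ρ / (n + 1) : ℝ) : ℂ)) atTop (𝓝[≠] y) := by
        apply tendsto_nhdsWithin_of_tendsto_nhds_of_eventually_within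
        · have h1 : Tendsto (fun n : ℕ => (ρ / (n + 1) : ℝ)) atTop (𝓝 0) := by
            have := (tendsto_one_div_add_atTop_nhds_zero_nat (𝕜 := ℝ)).const_mul ρ
            simpa [div_eq_mul_inv] using this
          have h2 := (Complex.continuous_ofReal.tendsto 0).comp h1
          simpa using h2.const_add y
        · refine Eventually.of_forall fun n => ?_
          have : ρ / ((n:ℝ) + 1) ≠ 0 := by positivity
          simp only [mem_compl_iff, mem_singleton_iff, add_eq_left]
          exact_mod_cast this
      have hmem : ∀ᶠ n : ℕ in atTop, y + ((ρ / (n + 1) : ℝ) : ℂ) ∈ ball t0 R :=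
        (hseq.mono_right nhdsWithin_le_nhds) (isOpen_ball.mem_nhds hy)
      obtain ⟨N, hN⟩ := eventually_atTop.1 hmem
      refine aestronglyMeasurable_of_tendsto_ae (u := atTop)
        (f := fun (n : ℕ) θ => slope (fun t => H t θ) y (y + ((ρ / ((n + N : ℕ) + 1) : ℝ) : ℂ)))
        ?_ ?_
      · intro n
        apply Continuous.aestronglyMeasurable
        simp only [slope_def_module]
        have h1 := hc _ (hN (n + N) (by omega))
        have h2 := hc _ hy
        simp only [smul_eq_mul]
        exact continuous_const.mul (h1.sub h2)
      · refine Eventually.of_forall fun θ => ?_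
        have h3 := (hda θ y (mem_ball_self hρ)).tendsto_slope
        exact (h3.comp hseq).comp (tendsto_add_atTop_nat N))
    (by
      refine Eventually.of_forall fun θ _ x hx => ?_
      have hss : closedBall x ρ ⊆ ball y (2 * ρ) := by
        intro u hu
        have := dist_triangle u x y
        simp only [mem_ball, mem_closedBall] at *
        linarith
      apply Complex.norm_deriv_le_of_forall_mem_sphere_norm_le hρ
      · apply DifferentiableOn.diffContOnCl
        rw [closure_ball _ hρ.ne']
        exact (hd θ).mono (hss.trans hsub)
      · intro z hz
        exact hM z (hsub (hss (sphere_subset_closedBall hz))) θ)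
    (by simp)
    (Eventually.of_forall fun θ _ x hx => hda θ x hx)
  exact key.2.differentiableAt.differentiableWithinAt

lemma hart_lemma {a : ℕ → ℂ → ℂ} {t0 : ℂ} {R M C : ℝ} (hR : 0 < R) (hC : 0 < C)
    (ha : ∀ k, DifferentiableOn ℂ (a k) (ball t0 (2 * R)))
    (hM : ∀ k, ∀ t ∈ ball t0 (2 * R), ‖a k t‖ ≤ M * C ^ k)
    (hpt : ∀ t ∈ ball t0 (2 * R), ∀ ε > 0, ∃ N : ℝ, ∀ k, ‖a k t‖ ≤ N * ε ^ k) :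
    ∀ ε > 0, ∃ N : ℝ, ∀ k, ∀ t ∈ ball t0 R, ‖a k t‖ ≤ N * ε ^ k := by
  intro ε hε
  have hM0 : 0 ≤ M := by
    have := hM 0 t0 (mem_ball_self (by linarith))
    simp only [pow_zero, mul_one] at this
    exact (norm_nonneg _).trans this
  rcases le_total C ε with hCε | hCε
  · refine ⟨M, fun k t ht => (hM k t (ball_subset_ball (by linarith) ht)).trans ?_⟩
    gcongr
  set e := ε ^ 2 / C with he
  have he0 : 0 < e := by positivity
  have heC : e ≤ C := by
    rw [he, div_le_iff₀ hC]; nlinarith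
  let B : ℕ → Set ℂ := fun N => ⋃ k, (ball t0 (2 * R) ∩ {t | (N : ℝ) * e ^ k < ‖a k t‖})
  have hBo : ∀ N, IsOpen (B N) := by
    intro N
    refine isOpen_iUnion fun k => ?_
    exact ((ha k).continuousOn.norm).isOpen_inter_preimage isOpen_ball isOpen_Ioi
  have hBsub : ∀ N, B N ⊆ ball t0 (2 * R) := fun N => iUnion_subset fun k => inter_subset_left
  have hanti : Antitone B := by
    intro N N' h
    refine iUnion_mono fun k => inter_subset_inter_right _ ?_
    intro t ht
    rw [mem_ofPred_eq] at ht ⊢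
    refine lt_of_le_of_lt ?_ ht
    gcongr
  have hempty : ⋂ N, B N = ∅ := by
    rw [eq_empty_iff_forall_notMem]
    intro t ht
    rw [mem_iInter] at ht
    obtain ⟨N, hN⟩ := hpt t (hBsub 0 (ht 0)) e he0
    obtain ⟨n, hn⟩ := exists_nat_ge N
    obtain ⟨k, hk⟩ := mem_iUnion.1 (ht n)
    have h1 : (n : ℝ) * e ^ k < ‖a k t‖ := hk.2
    have h2 : N * e ^ k ≤ n * e ^ k := by gcongr
    linarith [hN k]
  have htend := tendsto_measure_iInter_atTop (μ := (volume : Measure ℂ))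
    (fun N => (hBo N).measurableSet.nullMeasurableSet) hanti
    ⟨0, ((measure_mono (hBsub 0)).trans_lt measure_ball_lt_top).ne⟩
  rw [hempty, measure_empty] at htend
  have hpos : 0 < ENNReal.ofReal (Real.pi * R ^ 2 / 2) := by
    rw [ENNReal.ofReal_pos]; positivity
  have hev := (htend.eventually (gt_mem_nhds hpos)).and (eventually_ge_atTop (⌈M⌉₊ + 1))
  obtain ⟨N, hN1, hN2⟩ := hev.exists
  have hNM : M ≤ N := (Nat.le_ceil M).trans (by exact_mod_cast (by omega))
  have hN0 : (0 : ℝ) < N := by exact_mod_cast (by omega)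
  refine ⟨N, fun k y hy => ?_⟩
  have hss : closedBall y R ⊆ ball t0 (2 * R) := by
    intro u hu
    have := dist_triangle u y t0
    simp only [mem_ball, mem_closedBall] at *
    linarith
  have hE : 0 < (N : ℝ) * e ^ k := by positivity
  have h2 := hart_two (f := fun t => a k t / ((N * e ^ k : ℝ) : ℂ)) (F := (C / e) ^ k) (c := y) hR
    (hBo N).measurableSet
    (by
      intro z hz
      have : DifferentiableOn ℂ (fun t => a k t / ((N * e ^ k : ℝ) : ℂ)) (ball t0 (2 * R)) :=
        (ha k).div_const _
      exact this.analyticAt (isOpen_ball.mem_nhds (hss hz)))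
    (one_le_pow₀ ((one_le_div he0).2 heC))
    (by
      intro z hz
      rw [norm_div, Complex.norm_real, Real.norm_of_nonneg hE.le, div_le_iff₀ hE]
      refine (hM k z (hss hz)).trans ?_
      have : (C / e) ^ k * (N * e ^ k) = N * C ^ k := by
        rw [div_pow]; field_simp
      rw [this]; gcongr)
    (by
      intro z hz hzB
      rw [norm_div, Complex.norm_real, Real.norm_of_nonneg hE.le, div_le_one hE]
      by_contra! hcon
      exact hzB (mem_iUnion.2 ⟨k, hss hz, hcon⟩))
    ((measure_mono inter_subset_left).trans_lt hN1)
  rw [norm_div, Complex.norm_real, Real.norm_of_nonneg hE.le, div_pow, div_le_iff₀ (by positivity)]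
    at h2
  have h3 : (C / e) ^ k * (N * e ^ k) ^ 2 = (N * ε ^ k) ^ 2 := by
    have : C * e = ε ^ 2 := by rw [he]; field_simp
    calc (C / e) ^ k * (N * e ^ k) ^ 2 = N ^ 2 * (C * e) ^ k := by
          rw [div_pow, mul_pow C e]; field_simp
      _ = _ := by rw [this]; ring
  rw [h3] at h2
  exact (pow_le_pow_iff_left₀ (norm_nonneg _) (by positivity) two_ne_zero).1 h2

lemma hart_coeff {G : ℂ → ℂ → ℂ} {t0 : ℂ} {R r M : ℝ} (hr : 0 < r)
    (hd : ∀ w, DifferentiableOn ℂ (fun t => G t w) (ball t0 R))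
    (hw : ∀ t ∈ ball t0 R, Differentiable ℂ (G t))
    (hM : ∀ t ∈ ball t0 R, ∀ w ∈ closedBall (0:ℂ) r, ‖G t w‖ ≤ M) (k : ℕ) :
    DifferentiableOn ℂ (fun t => iteratedDeriv k (G t) 0) (ball t0 R) := by
  have h1 : ∀ t ∈ ball t0 R, iteratedDeriv k (G t) 0 =
      (k.factorial / (2 * Real.pi * Complex.I)) * ∫ θ in (0:ℝ)..(2 * Real.pi),
      deriv (circleMap 0 r) θ • ((1 / (circleMap 0 r θ - 0) ^ (k + 1)) • G t (circleMap 0 r θ)) := by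
    intro t ht
    have := DiffContOnCl.circleIntegral_one_div_sub_center_pow_smul hr k
      ((hw t ht).diffContOnCl (s := ball 0 r))
    unfold circleIntegral at this
    rw [this]
    simp only [smul_eq_mul]
    have : (k.factorial : ℂ) ≠ 0 := by exact_mod_cast k.factorial_ne_zero
    have h2 : (Real.pi : ℂ) ≠ 0 := by exact_mod_cast Real.pi_ne_zero
    field_simp
  refine DifferentiableOn.congr (DifferentiableOn.const_mul ?_ _) h1
  have hne : ∀ θ, (circleMap 0 r θ - 0) ^ (k + 1) ≠ 0 := by
    intro θ
    rw [sub_zero]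
    exact pow_ne_zero _ (circleMap_ne_center hr.ne')
  apply hart_param (M := r * ((1 / r ^ (k + 1)) * M))
  · intro t ht
    simp only [deriv_circleMap]
    have h3 : Continuous fun θ => G t (circleMap 0 r θ) :=
      (hw t ht).continuous.comp (continuous_circleMap 0 r)
    have h4 : Continuous fun θ => 1 / (circleMap 0 r θ - 0) ^ (k + 1) :=
      continuous_const.div (by fun_prop) hne
    exact ((continuous_circleMap 0 r).mul continuous_const).smul (h4.smul h3)
  · intro θ
    exact DifferentiableOn.fun_const_smul (DifferentiableOn.fun_const_smul (hd _) _) _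
  · intro t ht θ
    rw [norm_smul, norm_smul]
    have h5 : ‖circleMap 0 r θ‖ = r := by simp [abs_of_pos hr]
    have h6 := hM t ht (circleMap 0 r θ) (by simp [abs_of_pos hr])
    simp only [deriv_circleMap, sub_zero, norm_mul, norm_div, norm_pow, Complex.norm_I, mul_one,
      norm_one, h5]
    gcongr

lemma hart_bdd {g : ℂ → ℂ → ℂ} {V : Set ℂ} (hV : IsOpen V)
    (hd : ∀ w, DifferentiableOn ℂ (fun t => g t w) V)
    (hw : ∀ t ∈ V, Differentiable ℂ (g t)) {t0 : ℂ} (ht0 : t0 ∈ V) (w0 : ℂ) :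
    ∃ s > 0, ball t0 s ⊆ V ∧ ∃ N : ℝ, ∀ t ∈ ball t0 s, ∀ w ∈ ball w0 1, ‖g t w‖ ≤ N := by
  obtain ⟨R, hR, hsub⟩ : ∃ R > 0, closedBall t0 (2 * R) ⊆ V := by
    obtain ⟨ε, hε, h⟩ := Metric.nhds_basis_closedBall.mem_iff.1 (hV.mem_nhds ht0)
    exact ⟨ε / 2, by positivity, by rwa [mul_div_cancel₀ _ two_ne_zero]⟩
  -- Baire
  have hclosed : ∀ n : ℕ, IsClosed {w | ∀ t ∈ closedBall t0 (2 * R), ‖g t w‖ ≤ n} := by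
    intro n
    simp only [ofPred_forall]
    refine isClosed_iInter fun t => isClosed_iInter fun ht => ?_
    exact isClosed_le (hw t (hsub ht)).continuous.norm continuous_const
  have hun : ⋃ n : ℕ, {w | ∀ t ∈ closedBall t0 (2 * R), ‖g t w‖ ≤ n} = univ := by
    rw [eq_univ_iff_forall]
    intro w
    obtain ⟨b, hb⟩ := (isCompact_closedBall t0 (2 * R)).exists_bound_of_continuousOn
      ((hd w).continuousOn.mono hsub)
    obtain ⟨n, hn⟩ := exists_nat_ge b
    exact mem_iUnion.2 ⟨n, fun t ht => (hb t ht).trans hn⟩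
  obtain ⟨n, w1, hw1⟩ := nonempty_interior_of_iUnion_of_closed hclosed hun
  obtain ⟨r, hr, hball⟩ := Metric.nhds_basis_closedBall.mem_iff.1
    (mem_interior_iff_mem_nhds.1 hw1)
  set G : ℂ → ℂ → ℂ := fun t w => g t (w + w1) with hG
  have hsub' : ball t0 (2 * R) ⊆ V := ball_subset_closedBall.trans hsub
  have hGd : ∀ w, DifferentiableOn ℂ (fun t => G t w) (ball t0 (2 * R)) :=
    fun w => (hd _).mono hsub'
  have hGw : ∀ t ∈ ball t0 (2 * R), Differentiable ℂ (G t) := by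
    intro t ht
    exact (hw t (hsub' ht)).comp (differentiable_id.add_const w1)
  have hGM : ∀ t ∈ ball t0 (2 * R), ∀ w ∈ closedBall (0:ℂ) r, ‖G t w‖ ≤ n := by
    intro t ht w hw
    refine hball (a := w + w1) ?_ t (ball_subset_closedBall ht)
    simpa [dist_eq_norm] using hw
  let a : ℕ → ℂ → ℂ := fun k t => iteratedDeriv k (G t) 0 / k.factorial
  have hest : ∀ k, ∀ t ∈ ball t0 (2 * R), ∀ ρ > 0, ∀ N : ℝ, (∀ w ∈ closedBall (0:ℂ) ρ, ‖G t w‖ ≤ N) →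
      ‖a k t‖ ≤ N * (1 / ρ) ^ k := by
    intro k t ht ρ hρ N hN
    have h1 := Complex.norm_iteratedDeriv_le_of_forall_mem_sphere_norm_le k hρ
      ((hGw t ht).diffContOnCl (s := ball 0 ρ)) (fun z hz => hN z (sphere_subset_closedBall hz))
    have h2 : (0:ℝ) < k.factorial := by exact_mod_cast k.factorial_pos
    simp only [a, norm_div, Complex.norm_natCast]
    rw [div_le_iff₀ h2]
    refine h1.trans (le_of_eq ?_)
    rw [one_div, inv_pow]; field_simp
  have hH := hart_lemma (a := a) (t0 := t0) (R := R) (M := n) (C := 1 / r) hR (by positivity)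
    (fun k => (hart_coeff hr hGd hGw hGM k).div_const _)
    (fun k t ht => hest k t ht r hr n (hGM t ht))
    (by
      intro t ht ε hε
      obtain ⟨b, hb⟩ := (isCompact_closedBall (0:ℂ) (1 / ε)).exists_bound_of_continuousOn
        (hGw t ht).continuous.continuousOn
      refine ⟨b, fun k => ?_⟩
      simpa using hest k t ht (1 / ε) (by positivity) b hb)
  set ρ := ‖w0 - w1‖ + 1 with hρ
  have hρ0 : 0 < ρ := by positivity
  obtain ⟨N, hN⟩ := hH (1 / (2 * ρ)) (by positivity)
  refine ⟨R, hR, (ball_subset_ball (by linarith)).trans hsub', N * 2, fun t ht w hw' => ?_⟩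
  have ht2 : t ∈ ball t0 (2 * R) := ball_subset_ball (by linarith) ht
  have hs := Complex.hasSum_taylorSeries_of_entire (hGw t ht2) 0 (w - w1)
  have hgw : G t (w - w1) = g t w := by simp [hG]
  rw [hgw] at hs
  have hwρ : ‖w - w1‖ ≤ ρ := by
    have : ‖w - w1‖ ≤ ‖w - w0‖ + ‖w0 - w1‖ := norm_sub_le_norm_sub_add_norm_sub _ _ _
    rw [mem_ball, dist_eq_norm] at hw'
    linarith
  have hgeo : HasSum (fun k : ℕ => N * (1 / 2 : ℝ) ^ k) (N * 2) := hasSum_geometric_two.mul_left N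
  rw [← hs.tsum_eq]
  refine tsum_of_norm_bounded hgeo fun k => ?_
  have h1 := hN k t ht
  have h2 : (k.factorial : ℂ)⁻¹ • (w - w1 - 0) ^ k • iteratedDeriv k (G t) 0
      = (w - w1) ^ k * a k t := by
    simp only [a, smul_eq_mul, sub_zero]; ring
  rw [h2, norm_mul, norm_pow]
  calc ‖w - w1‖ ^ k * ‖a k t‖ ≤ ρ ^ k * (N * (1 / (2 * ρ)) ^ k) := by gcongr
    _ = N * (1 / 2) ^ k := by
      rw [div_pow, div_pow, mul_pow]; field_simp

lemma hart_chain {g : ℂ → ℂ → ℂ} {V : Set ℂ} (hV : IsOpen V)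
    (hd : ∀ w, DifferentiableOn ℂ (fun t => g t w) V)
    (hw : ∀ t ∈ V, Differentiable ℂ (g t)) {t0 : ℂ} (ht0 : t0 ∈ V) {ξ : ℂ → ℂ} {ξ' : ℂ}
    (hξ : HasDerivAt ξ ξ' t0) :
    HasDerivAt (fun t => g t (ξ t)) (deriv (fun t => g t (ξ t0)) t0 + deriv (g t0) (ξ t0) * ξ') t0 := by
  obtain ⟨s, hs, hsV, N, hN⟩ := hart_bdd hV hd hw ht0 (ξ t0)
  -- Lipschitz in w
  have hlip : ∀ t ∈ ball t0 s, ∀ w ∈ ball (ξ t0) 1,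
      ‖g t w - g t (ξ t0)‖ ≤ 2 * N * ‖w - ξ t0‖ := by
    intro t ht w hwb
    have h1 := Complex.dist_le_div_mul_dist_of_mapsTo_ball (f := g t) (c := ξ t0) (R₁ := 1)
      (R₂ := 2 * N) (z := w) (hw t (hsV ht)).differentiableOn
      (by
        intro u hu
        rw [mem_closedBall, dist_eq_norm]
        have := norm_sub_le (g t u) (g t (ξ t0))
        have h2 := hN t ht u hu
        have h3 := hN t ht (ξ t0) (mem_ball_self one_pos)
        linarith) hwb
    simpa [dist_eq_norm] using h1
  have hmix : ∀ t ∈ ball t0 s, ∀ w ∈ ball (ξ t0) 1,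
      ‖(g t w - g t (ξ t0)) - (g t0 w - g t0 (ξ t0))‖ ≤ 4 * N * ‖w - ξ t0‖ / s * ‖t - t0‖ := by
    intro t ht w hwb
    have h1 := Complex.dist_le_div_mul_dist_of_mapsTo_ball
      (f := fun t => g t w - g t (ξ t0)) (c := t0) (R₁ := s)
      (R₂ := 4 * N * ‖w - ξ t0‖) (z := t) (((hd w).sub (hd _)).mono hsV)
      (by
        intro u hu
        rw [mem_closedBall, dist_eq_norm]
        have := norm_sub_le (g u w - g u (ξ t0)) (g t0 w - g t0 (ξ t0))
        have h2 := hlip u hu w hwb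
        have h3 := hlip t0 (mem_ball_self hs) w hwb
        linarith) ht
    simpa [dist_eq_norm] using h1
  have hA : HasDerivAt (fun t => g t (ξ t0)) (deriv (fun t => g t (ξ t0)) t0) t0 :=
    ((hd _).differentiableAt (hV.mem_nhds ht0)).hasDerivAt
  have hB : HasDerivAt (fun t => g t0 (ξ t)) (deriv (g t0) (ξ t0) * ξ') t0 :=
    ((hw t0 ht0) (ξ t0)).hasDerivAt.comp t0 hξ
  have hC : HasDerivAt (fun t => (g t (ξ t) - g t (ξ t0)) - (g t0 (ξ t) - g t0 (ξ t0))) 0 t0 := by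
    rw [hasDerivAt_iff_isLittleO]
    simp only [sub_self, sub_zero, smul_zero]
    have hO : (fun t => (g t (ξ t) - g t (ξ t0)) - (g t0 (ξ t) - g t0 (ξ t0)))
        =O[𝓝 t0] fun t => (ξ t - ξ t0) * (t - t0) := by
      apply Asymptotics.IsBigO.of_bound (4 * N / s)
      filter_upwards [ball_mem_nhds t0 hs, hξ.continuousAt (ball_mem_nhds (ξ t0) one_pos)]
        with t ht1 ht2
      refine (hmix t ht1 (ξ t) ht2).trans (le_of_eq ?_)
      rw [norm_mul]; ring
    refine hO.trans_isLittleO ?_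
    have h1 : (fun t => ξ t - ξ t0) =o[𝓝 t0] fun _ => (1 : ℂ) := by
      rw [Asymptotics.isLittleO_one_iff]
      simpa using hξ.continuousAt.tendsto.sub_const (ξ t0)
    simpa using h1.mul_isBigO (Asymptotics.isBigO_refl (fun t => t - t0) (𝓝 t0))
  have hsum := ((hA.add hB).add hC).sub_const (g t0 (ξ t0))
  rw [add_zero] at hsum
  refine hsum.congr_of_eventuallyEq (Eventually.of_forall fun t => ?_)
  simp only [Pi.add_apply]; ring

lemma hart_multi {n : ℕ} {F : (Fin n → ℂ) → ℂ}
    (hF : ∀ (x : Fin n → ℂ) (i : Fin n),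
      DifferentiableAt ℂ (fun w => F (Function.update x i w)) (x i))
    {V : Set ℂ} (hV : IsOpen V) {x : Fin n → ℂ → ℂ} (hx : ∀ i, DifferentiableOn ℂ (x i) V)
    (S : Finset (Fin n)) : ∀ (y : Fin n → ℂ), ∀ t0 ∈ V,
    HasDerivAt (fun t => F (fun j => if j ∈ S then x j t else y j))
      (∑ i ∈ S, deriv (x i) t0 * deriv (fun w => F (Function.update
        (fun j => if j ∈ S then x j t0 else y j) i w)) (x i t0)) t0 := by
  induction S using Finset.induction_on with
  | empty =>
    intro y t0 _
    simpa using hasDerivAt_const t0 (F y)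
  | insert a S ha ih =>
    intro y t0 ht0
    have hupd : ∀ t w, (fun j => if j ∈ S then x j t else Function.update y a w j) =
        Function.update (fun j => if j ∈ S then x j t else y j) a w := by
      intro t w
      funext j
      by_cases hj : j = a
      · subst hj; simp [ha]
      · simp [hj]
    have hins : ∀ t, (fun j => if j ∈ insert a S then x j t else y j) =
        Function.update (fun j => if j ∈ S then x j t else y j) a (x a t) := by
      intro t
      funext j
      by_cases hj : j = a
      · subst hj; simp
      · simp [hj]
    have hc := hart_chain (V := V) (t0 := t0) (ξ := x a) (ξ' := deriv (x a) t0)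
      (g := fun t w => F (Function.update (fun j => if j ∈ S then x j t else y j) a w)) hV
      (by
        intro w t ht
        have := ih (Function.update y a w) t ht
        simp only [hupd] at this
        exact this.differentiableAt.differentiableWithinAt)
      (by
        intro t ht w
        have := hF (Function.update (fun j => if j ∈ S then x j t else y j) a w) a
        simpa using this) ht0
      (((hx a).differentiableAt (hV.mem_nhds ht0)).hasDerivAt)
    have hI := (ih (Function.update y a (x a t0)) t0 ht0).deriv
    simp only [hupd] at hI
    simp only [hins]
    convert hc using 1
    rw [Finset.sum_insert ha, hI, add_comm]
    simp only [Function.update_idem]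
    ring

end Hartogs

/-- For a non-degenerate `Φ(z,x)` satisfying the stationary equation and the
Euler homogeneity relation, `φ(z,t) = Φ(z,x(t))` satisfies the evolution
equation `∂φ/∂t = H₂φ - h H₀φ` iff `x(t)` solves
`x_k' = p_{k+1}(x) - 2k h x_k`. Here `i : Fin n` stands for `k = i + 2`. -/
theorem evolution_iff_dynamical_system
    (n : ℕ) (hn : 1 ≤ n) (δ : ℕ) (hδ : δ = 0 ∨ δ = 1) (c : ℂ)
    (p : Fin n → (Fin n → ℂ) → ℂ)
    (hpoly : ∀ i, ∃ P : MvPolynomial (Fin n) ℂ, ∀ x, p i x = MvPolynomial.eval x P)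
    (Φ : ℂ → (Fin n → ℂ) → ℂ)
    (hΦx : ∀ (z : ℂ) (x : Fin n → ℂ) (i : Fin n),
      DifferentiableAt ℂ (fun w => Φ z (Function.update x i w)) (x i))
    (hΦz : ∀ (z : ℂ) (x : Fin n → ℂ), DifferentiableAt ℂ (fun w => Φ w x) z ∧
      DifferentiableAt ℂ (deriv fun w => Φ w x) z)
    (hPDE : ∀ (z : ℂ) (x : Fin n → ℂ),
      (1 / 2) * deriv (deriv fun w => Φ w x) z
          - (c / (4 * (1 + 2 * (δ : ℂ)))) * x ⟨0, hn⟩ * z ^ 2 * Φ z x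
        = ∑ i : Fin n, p i x * deriv (fun w => Φ z (Function.update x i w)) (x i))
    (hEuler : ∀ (z : ℂ) (x : Fin n → ℂ),
      z * deriv (fun w => Φ w x) z - (δ : ℂ) * Φ z x
        = ∑ i : Fin n, 2 * ((i : ℕ) + 2) * x i *
            deriv (fun w => Φ z (Function.update x i w)) (x i))
    (hnondeg : ∀ g : (Fin n → ℂ) → Fin n → ℂ,
      (∀ (z : ℂ) (x : Fin n → ℂ),
        ∑ i : Fin n, g x i * deriv (fun w => Φ z (Function.update x i w)) (x i) = 0) →
      ∀ x, g x = 0)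
    (V : Set ℂ) (hV : IsOpen V)
    (h : ℂ → ℂ) (hh : DifferentiableOn ℂ h V)
    (x : Fin n → ℂ → ℂ) (hx : ∀ i, DifferentiableOn ℂ (x i) V)
    (φ : ℂ → ℂ → ℂ) (hφ : ∀ z t, φ z t = Φ z (fun j => x j t)) :
    (∀ z : ℂ, ∀ t ∈ V,
        deriv (fun v => φ z v) t =
          (1 / 2) * deriv (deriv fun w => φ w t) z
            - (c / (4 * (1 + 2 * (δ : ℂ)))) * x ⟨0, hn⟩ t * z ^ 2 * φ z t
            - h t * (z * deriv (fun w => φ w t) z - (δ : ℂ) * φ z t)) ↔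
    (∀ i, ∀ t ∈ V,
        deriv (x i) t = p i (fun j => x j t) - 2 * ((i : ℕ) + 2) * h t * x i t) := by
  have hchain : ∀ z : ℂ, ∀ t ∈ V, deriv (fun v => φ z v) t =
      ∑ i : Fin n, deriv (x i) t *
        deriv (fun w => Φ z (Function.update (fun j => x j t) i w)) (x i t) := by
    intro z t ht
    have := (hart_multi (hΦx z) hV hx Finset.univ 0 t ht).deriv
    simpa only [hφ, Finset.mem_univ, if_true] using this
  have hrhs : ∀ z : ℂ, ∀ t, (1 / 2) * deriv (deriv fun w => φ w t) z
            - (c / (4 * (1 + 2 * (δ : ℂ)))) * x ⟨0, hn⟩ t * z ^ 2 * φ z t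
            - h t * (z * deriv (fun w => φ w t) z - (δ : ℂ) * φ z t) =
      ∑ i : Fin n, (p i (fun j => x j t) - 2 * ((i : ℕ) + 2) * h t * x i t) *
        deriv (fun w => Φ z (Function.update (fun j => x j t) i w)) (x i t) := by
    intro z t
    simp only [hφ]
    rw [hPDE z (fun j => x j t), hEuler z (fun j => x j t), Finset.mul_sum,
      ← Finset.sum_sub_distrib]
    refine Finset.sum_congr rfl fun i _ => ?_
    ring
  constructor
  · intro H i t ht
    classical
    have hg := hnondeg (fun y i => if y = (fun j => x j t) then
      deriv (x i) t - (p i (fun j => x j t) - 2 * ((i : ℕ) + 2) * h t * x i t) else 0) (by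
        intro z y
        by_cases hy : y = fun j => x j t
        · subst hy
          have h1 := H z t ht
          rw [hchain z t ht, hrhs z t, ← sub_eq_zero, ← Finset.sum_sub_distrib] at h1
          rw [← h1]
          refine Finset.sum_congr rfl fun i _ => ?_
          simp only [if_true]
          ring
        · simp [hy]) (fun j => x j t)
    have h2 := congrFun hg i
    simp only [if_true, Pi.zero_apply] at h2
    exact sub_eq_zero.1 h2
  · intro H z t ht
    rw [hchain z t ht, hrhs z t]
    refine Finset.sum_congr rfl fun i _ => ?_
    rw [H i t ht]
end

section
/- For a complex-differentiable function h on an open set V ⊆ ℂ define the sequence of functions D₁(h) = h' + h² and D_m(h) = (D_{m−1}(h))' + 2m h · D_{m−1}(h) for m ≥ 2 (all derivatives exist since h is analytic). Let n ≥ 2 and let P ∈ ℂ[y₁,…,y_{n−1}] be a polynomial that is weighted homogeneous of weighted degree n+2 when y_k is assigned weight k+1. Define dP = Σ_{k=1}^{n−1} y_{k+1} ∂P/∂y_k ∈ ℂ[y₁,…,y_n]. Then for every complex-differentiable h : V → ℂ, the identity (D_{n+1}(h) − P(D₁(h),…,D_{n−1}(h)))' + 2(n+2) h · (D_{n+1}(h)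 − P(D₁(h),…,D_{n−1}(h))) = D_{n+2}(h) − (dP)(D₁(h),…,D_n(h)) holds on V. -/
/-- The differential polynomials `D_m(h)`: `D₁(h) = h' + h²` and
`D_m(h) = (D_{m-1}(h))' + 2m h D_{m-1}(h)` for `m ≥ 2`. -/
noncomputable def Dseq (h : ℂ → ℂ) : ℕ → ℂ → ℂ
  | 0 => h
  | 1 => fun t => deriv h t + h t ^ 2
  | (m + 2) => fun t =>
      deriv (Dseq h (m + 1)) t + 2 * ((m : ℂ) + 2) * h t * Dseq h (m + 1) t

lemma derivation_sum_apply' (s : Finset ℕ)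
    (D : ℕ → Derivation ℂ (MvPolynomial ℕ ℂ) (MvPolynomial ℕ ℂ)) (p : MvPolynomial ℕ ℂ) :
    (∑ j ∈ s, D j) p = ∑ j ∈ s, D j p := by
  induction s using Finset.cons_induction with
  | empty => simp
  | cons a s ha ih => rw [Finset.sum_cons, Finset.sum_cons, Derivation.add_apply, ih]

open MvPolynomial in
lemma euler_mkDerivation (w : ℕ → ℕ) (P : MvPolynomial ℕ ℂ) (N : ℕ)
    (hP : MvPolynomial.IsWeightedHomogeneous w P N) :
    mkDerivation ℂ (fun j => C (w j : ℂ) * X j) P = C (N : ℂ) * P := by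
  have key : ∀ (s : ℕ →₀ ℕ) (r : ℂ),
      mkDerivation ℂ (fun j => C (w j : ℂ) * (X j : MvPolynomial ℕ ℂ)) (monomial s r)
        = C ((Finsupp.weight w s : ℕ) : ℂ) * monomial s r := by
    intro s r
    rw [mkDerivation_monomial, Finsupp.weight_apply, Finsupp.sum, Finsupp.sum]
    have : ∀ i ∈ s.support, monomial (s - Finsupp.single i 1) ((s i : ℕ) : ℂ) •
        (C (w i : ℂ) * (X i : MvPolynomial ℕ ℂ)) = monomial s ((s i • w i : ℕ) : ℂ) := by
      intro i hi
      have h1 : s - Finsupp.single i 1 + Finsupp.single i 1 = s := by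
        apply tsub_add_cancel_of_le
        rw [Finsupp.single_le_iff]
        exact Nat.one_le_iff_ne_zero.2 (Finsupp.mem_support_iff.1 hi)
      rw [smul_eq_mul, X, C_mul_monomial, monomial_mul, h1]
      simp
    rw [Finset.sum_congr rfl this, ← map_sum, smul_monomial, C_mul_monomial]
    congr 1
    push_cast
    rw [smul_eq_mul, mul_comm]
  conv_lhs => rw [P.as_sum]
  conv_rhs => rw [P.as_sum]
  rw [map_sum, Finset.mul_sum]
  refine Finset.sum_congr rfl fun s hs => ?_
  rw [key, hP (mem_support_iff.1 hs)]

open MvPolynomial in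
lemma hasDerivAt_eval_mkDerivation (F : ℕ → ℂ → ℂ) (t : ℂ) (g : ℕ → MvPolynomial ℕ ℂ)
    (hF : ∀ j, HasDerivAt (F j) (eval (fun i => F i t) (g j)) t) (P : MvPolynomial ℕ ℂ) :
    HasDerivAt (fun u => eval (fun j => F j u) P)
      (eval (fun j => F j t) (mkDerivation ℂ g P)) t := by
  induction P using MvPolynomial.induction_on with
  | C a => simpa using hasDerivAt_const t a
  | add p q hp hq =>
    simp only [map_add]
    exact hp.add hq
  | mul_X p i hp =>
    have := hp.mul (hF i)
    simp only [Derivation.leibniz, mkDerivation_X, map_add, smul_eq_mul, map_mul, eval_X]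
    refine this.congr_deriv ?_
    ring

lemma Dseq_differentiableOn (V : Set ℂ) (hV : IsOpen V)
    (h : ℂ → ℂ) (hh : DifferentiableOn ℂ h V) :
    ∀ m, DifferentiableOn ℂ (Dseq h (m + 1)) V := by
  intro m
  induction m with
  | zero =>
    have := (hh.deriv hV).add (hh.pow 2)
    exact this
  | succ m ih =>
    have := (ih.deriv hV).add ((hh.const_mul (2 * ((m : ℂ) + 2))).mul ih)
    exact this

/-- `(d/dt + 2(n+2)h) D_{P,n+1}(h) = D_{dP,n+2}(h)` where
`dP = Σ_k y_{k+1} ∂P/∂y_k`. Here `P` is a polynomial in variables indexed by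
`ℕ`, the index `j` standing for `y_{j+1}` (of weight `j + 2`), which only
involves `y₁, …, y_{n-1}` and is weighted homogeneous of weighted degree
`n + 2`; the evaluation substitutes `D_{j+1}(h)` for the index `j`. -/
theorem ODE_shift_identity
    (n : ℕ) (hn : 2 ≤ n)
    (P : MvPolynomial ℕ ℂ)
    (hPvars : ∀ j ∈ P.vars, j < n - 1)
    (hPhom : MvPolynomial.IsWeightedHomogeneous (fun j => j + 2) P (n + 2))
    (V : Set ℂ) (hV : IsOpen V)
    (h : ℂ → ℂ) (hh : DifferentiableOn ℂ h V) :
    ∀ t ∈ V,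
      deriv (fun u => Dseq h (n + 1) u -
          MvPolynomial.eval (fun j => Dseq h (j + 1) u) P) t
        + 2 * ((n : ℂ) + 2) * h t *
          (Dseq h (n + 1) t - MvPolynomial.eval (fun j => Dseq h (j + 1) t) P)
      = Dseq h (n + 2) t -
          MvPolynomial.eval (fun j => Dseq h (j + 1) t)
            (∑ j ∈ Finset.range (n - 1),
              MvPolynomial.X (j + 1) * MvPolynomial.pderiv j P) := by
  intro t ht
  have hd : ∀ m, HasDerivAt (Dseq h (m + 1)) (deriv (Dseq h (m + 1)) t) t := fun m =>
    ((Dseq_differentiableOn V hV h hh m).differentiableAt (hV.mem_nhds ht)).hasDerivAt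
  have hrec : ∀ m, Dseq h (m + 2) t =
      deriv (Dseq h (m + 1)) t + 2 * ((m : ℂ) + 2) * h t * Dseq h (m + 1) t := fun m => rfl
  let g : ℕ → MvPolynomial ℕ ℂ := fun j =>
    MvPolynomial.X (j + 1) -
      MvPolynomial.C (2 * h t) * (MvPolynomial.C ((j + 2 : ℕ) : ℂ) * MvPolynomial.X j)
  have hP := hasDerivAt_eval_mkDerivation (fun j => Dseq h (j + 1)) t g (by
    intro j
    refine (hd j).congr_deriv ?_
    simp only [g, map_sub, map_mul, MvPolynomial.eval_X, MvPolynomial.eval_C]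
    rw [hrec j]
    push_cast
    ring) P
  have hg : MvPolynomial.mkDerivation ℂ g P =
      (∑ j ∈ Finset.range (n - 1), MvPolynomial.X (j + 1) * MvPolynomial.pderiv j P)
      - MvPolynomial.C (2 * h t) * (MvPolynomial.C ((n + 2 : ℕ) : ℂ) * P) := by
    rw [← euler_mkDerivation (fun j => j + 2) P (n + 2) hPhom]
    have := MvPolynomial.derivation_eq_of_forall_mem_vars (f := P)
      (D₁ := MvPolynomial.mkDerivation ℂ g)
      (D₂ := (∑ j ∈ Finset.range (n - 1),
          (MvPolynomial.X (j + 1) : MvPolynomial ℕ ℂ) • MvPolynomial.pderiv j)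
        - (MvPolynomial.C (2 * h t) : MvPolynomial ℕ ℂ) • MvPolynomial.mkDerivation ℂ
          (fun j => MvPolynomial.C ((j + 2 : ℕ) : ℂ) * MvPolynomial.X j)) (by
        intro i hi
        have hi' := hPvars i hi
        simp only [Derivation.sub_apply, Derivation.smul_apply, MvPolynomial.mkDerivation_X,
          derivation_sum_apply',
          MvPolynomial.pderiv_X, smul_eq_mul, g]
        congr 1
        rw [Finset.sum_eq_single i]
        · simp
        · intro b _ hb
          simp [Pi.single_apply, hb.symm]
        · intro hn'
          exact absurd (Finset.mem_range.2 hi') hn')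
    rw [this]
    simp only [Derivation.sub_apply, Derivation.smul_apply, 
          derivation_sum_apply', smul_eq_mul]
  have hderiv : deriv (fun u => Dseq h (n + 1) u -
      MvPolynomial.eval (fun j => Dseq h (j + 1) u) P) t = _ := ((hd n).sub hP).deriv
  rw [hderiv, hg, hrec n]
  simp only [map_sub, map_mul, MvPolynomial.eval_C]
  push_cast
  ring
end

section
/- Let n ≥ 0. Assign to the variable x_q the weight q for q = 2,…,n+1. Then the ℂ-vector space of polynomials in x₂,…,x_{n+1} that are weighted homogeneous of weighted degree n+2 has dimension p(n+2) − p(n+1) − 1, where p(m) denotes the number of partitions of the natural number m. -/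
/-- Multisets of variables of total weight `n + 2`, partitions of `n + 1`, and one extra point
map to partitions of `n + 2`. -/
def partMap (n : ℕ) :
    ({m : Multiset (Fin n) // (m.map (fun i : Fin n => (i : ℕ) + 2)).sum = n + 2}
      ⊕ Nat.Partition (n + 1)) ⊕ Unit → Nat.Partition (n + 2)
  | Sum.inl (Sum.inl m) =>
      { parts := m.1.map (fun i : Fin n => (i : ℕ) + 2)
        parts_pos := by
          intro i hi
          obtain ⟨a, _, rfl⟩ := Multiset.mem_map.1 hi
          omega
        parts_sum := m.2 }
  | Sum.inl (Sum.inr q) =>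
      { parts := 1 ::ₘ q.parts
        parts_pos := by
          intro i hi
          rcases Multiset.mem_cons.1 hi with rfl | h
          · exact Nat.one_pos
          · exact q.parts_pos h
        parts_sum := by rw [Multiset.sum_cons, q.parts_sum]; omega }
  | Sum.inr _ =>
      { parts := {n + 2}
        parts_pos := by
          intro i hi
          rw [Multiset.mem_singleton] at hi
          omega
        parts_sum := by simp }

theorem weight_inj (n : ℕ) : Function.Injective (fun i : Fin n => (i : ℕ) + 2) := by
  intro a b h
  apply Fin.ext
  simpa using h

theorem partMap_bijective (n : ℕ) : Function.Bijective (partMap n) := by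
  constructor
  · rintro ((⟨m, hm⟩ | q) | u) ((⟨m', hm'⟩ | q') | u') h
    · have h := congrArg Nat.Partition.parts h
      simp only [partMap] at h
      have := Multiset.map_injective (weight_inj n) h
      subst this
      rfl
    · have h := congrArg Nat.Partition.parts h
      simp only [partMap] at h
      have : 1 ∈ m.map (fun i : Fin n => (i : ℕ) + 2) := by rw [h]; simp
      obtain ⟨a, _, ha⟩ := Multiset.mem_map.1 this
      omega
    · have h := congrArg Nat.Partition.parts h
      simp only [partMap] at h
      have : n + 2 ∈ m.map (fun i : Fin n => (i : ℕ) + 2) := by rw [h]; simp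
      obtain ⟨a, _, ha⟩ := Multiset.mem_map.1 this
      omega
    · have h := congrArg Nat.Partition.parts h
      simp only [partMap] at h
      have : 1 ∈ m'.map (fun i : Fin n => (i : ℕ) + 2) := by rw [← h]; simp
      obtain ⟨a, _, ha⟩ := Multiset.mem_map.1 this
      omega
    · have h := congrArg Nat.Partition.parts h
      simp only [partMap] at h
      rw [Nat.Partition.ext ((Multiset.cons_inj_right 1).1 h)]
    · have h := congrArg Nat.Partition.parts h
      simp only [partMap] at h
      have : 1 ∈ ({n + 2} : Multiset ℕ) := by rw [← h]; simp
      rw [Multiset.mem_singleton] at this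
      omega
    · have h := congrArg Nat.Partition.parts h
      simp only [partMap] at h
      have : n + 2 ∈ m'.map (fun i : Fin n => (i : ℕ) + 2) := by rw [← h]; simp
      obtain ⟨a, _, ha⟩ := Multiset.mem_map.1 this
      omega
    · have h := congrArg Nat.Partition.parts h
      simp only [partMap] at h
      have : 1 ∈ ({n + 2} : Multiset ℕ) := by rw [h]; simp
      rw [Multiset.mem_singleton] at this
      omega
    · rfl
  · intro p
    by_cases h1 : 1 ∈ p.parts
    · obtain ⟨t, ht⟩ := Multiset.exists_cons_of_mem h1
      refine ⟨Sum.inl (Sum.inr ⟨t, ?_, ?_⟩), ?_⟩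
      · intro i hi
        exact p.parts_pos (by rw [ht]; exact Multiset.mem_cons_of_mem hi)
      · have := p.parts_sum
        rw [ht, Multiset.sum_cons] at this
        omega
      · exact Nat.Partition.ext ht.symm
    · by_cases h2 : n + 2 ∈ p.parts
      · obtain ⟨t, ht⟩ := Multiset.exists_cons_of_mem h2
        refine ⟨Sum.inr (), Nat.Partition.ext ?_⟩
        have hs := p.parts_sum
        rw [ht, Multiset.sum_cons] at hs
        have ht0 : t = 0 := by
          apply Multiset.eq_zero_of_forall_notMem
          intro a ha
          have h3 := p.parts_pos (i := a) (by rw [ht]; exact Multiset.mem_cons_of_mem ha)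
          have h4 := Multiset.le_sum_of_mem ha
          omega
        rw [ht, ht0]
        rfl
      · have hp : ∀ a ∈ p.parts, ∃ i : Fin n, (i : ℕ) + 2 = a := by
          intro a ha
          have h3 := p.parts_pos ha
          have h4 := Nat.Partition.le_of_mem_parts ha
          have h5 : a ≠ 1 := fun h => h1 (h ▸ ha)
          have h6 : a ≠ n + 2 := fun h => h2 (h ▸ ha)
          exact ⟨⟨a - 2, by omega⟩, by simp only; omega⟩
        obtain ⟨m, hm⟩ : ∃ m : Multiset (Fin n),
            m.map (fun i : Fin n => (i : ℕ) + 2) = p.parts := by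
          haveI : CanLift ℕ (Fin n) (fun i : Fin n => (i : ℕ) + 2)
              (fun a => ∃ i : Fin n, (i : ℕ) + 2 = a) := ⟨fun _ h => h⟩
          exact CanLift.prf (β := Multiset (Fin n)) p.parts hp
        exact ⟨Sum.inl (Sum.inl ⟨m, by rw [hm, p.parts_sum]⟩), Nat.Partition.ext hm⟩

/-- Exponent vectors of weighted degree `n + 2` as multisets. -/
noncomputable def expEquiv (n : ℕ) :
    {d : Fin n →₀ ℕ | Finsupp.weight (fun i : Fin n => (i : ℕ) + 2) d = n + 2} ≃
    {m : Multiset (Fin n) // (m.map (fun i : Fin n => (i : ℕ) + 2)).sum = n + 2} :=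
  Equiv.subtypeEquiv (Multiset.toFinsupp (α := Fin n)).symm.toEquiv (by
    intro d
    have : ((Finsupp.toMultiset d).map (fun i : Fin n => (i : ℕ) + 2)).sum
        = Finsupp.weight (fun i : Fin n => (i : ℕ) + 2) d := by
      induction d using Finsupp.induction_linear with
      | zero => simp
      | add f g hf hg => rw [map_add, map_add, Multiset.map_add, Multiset.sum_add, hf, hg]
      | single a b =>
        rw [Finsupp.toMultiset_single, Multiset.map_nsmul, Multiset.sum_nsmul,
          Finsupp.weight_single]
        simp
    change Finsupp.weight (fun i : Fin n => (i : ℕ) + 2) d = n + 2 ↔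
      ((Finsupp.toMultiset d).map (fun i : Fin n => (i : ℕ) + 2)).sum = n + 2
    rw [this])

/-- The space of polynomials in `x₂, …, x_{n+1}` (the variable indexed by
`i : Fin n` standing for `x_{i+2}`, of weight `i + 2`) that are weighted
homogeneous of weighted degree `n + 2` has dimension
`p(n+2) - p(n+1) - 1`, where `p(m)` is the number of partitions of `m`. -/
theorem dim_weighted_homogeneous_eq_partition_diff (n : ℕ) :
    Module.finrank ℂ
      (MvPolynomial.weightedHomogeneousSubmodule ℂ
        (fun i : Fin n => (i : ℕ) + 2) (n + 2))
    = Fintype.card (Nat.Partition (n + 2)) - Fintype.card (Nat.Partition (n + 1)) - 1 := by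
  have hcard := Nat.card_congr (Equiv.ofBijective _ (partMap_bijective n))
  have hfin : Finite (({m : Multiset (Fin n) //
      (m.map (fun i : Fin n => (i : ℕ) + 2)).sum = n + 2}
      ⊕ Nat.Partition (n + 1)) ⊕ Unit) := Finite.of_injective _ (partMap_bijective n).1
  have hfin1 : Finite {m : Multiset (Fin n) //
      (m.map (fun i : Fin n => (i : ℕ) + 2)).sum = n + 2} :=
    Finite.of_injective (fun m => (Sum.inl (Sum.inl m) : ({m : Multiset (Fin n) //
      (m.map (fun i : Fin n => (i : ℕ) + 2)).sum = n + 2}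
      ⊕ Nat.Partition (n + 1)) ⊕ Unit)) (fun a b h => by simpa using h)
  rw [Nat.card_sum, Nat.card_sum, ← Nat.card_congr (expEquiv n)] at hcard
  simp only [Nat.card_eq_fintype_card (α := Nat.Partition _), Nat.card_unique] at hcard
  have key : Module.finrank ℂ
      (MvPolynomial.weightedHomogeneousSubmodule ℂ
        (fun i : Fin n => (i : ℕ) + 2) (n + 2)) =
      Nat.card {d : Fin n →₀ ℕ | Finsupp.weight (fun i : Fin n => (i : ℕ) + 2) d = n + 2} := by
    rw [← Module.finrank_eq_nat_card_basis (R := ℂ) (MvPolynomial.basisRestrictSupport ℂ _)]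
    have : MvPolynomial.weightedHomogeneousSubmodule ℂ
        (fun i : Fin n => (i : ℕ) + 2) (n + 2) = MvPolynomial.restrictSupport ℂ
        {d : Fin n →₀ ℕ | Finsupp.weight (fun i : Fin n => (i : ℕ) + 2) d = n + 2} := by
      ext p
      rw [MvPolynomial.mem_weightedHomogeneousSubmodule, MvPolynomial.mem_restrictSupport_iff]
      constructor
      · intro h d hd
        exact h (MvPolynomial.mem_support_iff.1 hd)
      · intro h d hd
        exact h (MvPolynomial.mem_support_iff.2 hd)
    rw [this]
  omega
end

section
/- Let n ≥ 0, and for j = 1,…,n+1 let p_{j+1} : ℂ^{n+1} → ℂ and ρ : ℂ^{n+1} → ℂ be polynomial functions of x = (x₁,…,x_{n+1}). Let Ψ : ℂ × ℂ^{n+1} → ℂ be complex-differentiable in each of the variables x_j, twice complex-differentiable in z, and satisfy (1/2)∂²Ψ/∂z² = Σ_{j=1}^{n+1} p_{j+1}(x) ∂Ψ/∂x_j + ρ(x) Ψ for all (z,x). Let V ⊆ ℂ be open and let r, x₁,…,x_{n+1} : V → ℂ be complex-differentiable with x_j'(t) = p_{j+1}(x₁(t),…,x_{n+1}(t)) for j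 = 1,…,n+1 and r'(t) = ρ(x₁(t),…,x_{n+1}(t)) on V. Then ψ(z,t) = e^{r(t)} Ψ(z, x₁(t),…,x_{n+1}(t)) solves the heat equation ∂ψ/∂t = (1/2)∂²ψ/∂z² on ℂ × V. -/
section Hartogs
open MeasureTheory Metric Set Filter Topology

/-- Osgood at a point: a bounded separately holomorphic function is differentiable. -/
lemma osgood_at {E : Type*} [NormedAddCommGroup E] [NormedSpace ℂ E] (f : E → ℂ → ℂ)
    (h1 : ∀ w, Differentiable ℂ (fun z => f z w)) (h2 : ∀ z, Differentiable ℂ (f z))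
    (z0 : E) (w0 : ℂ) (r M : ℝ) (hr : 0 < r)
    (hb : ∀ z ∈ ball z0 r, ∀ w ∈ ball w0 r, ‖f z w‖ ≤ M) :
    DifferentiableAt ℂ (fun q : E × ℂ => f q.1 q.2) (z0, w0) := by
  set g : E × ℂ → ℂ := fun q => f q.1 q.2 - f z0 q.2 - (f q.1 w0 - f z0 w0) with hg
  have hz0 : z0 ∈ ball z0 r := mem_ball_self hr
  have hw0 : w0 ∈ ball w0 r := mem_ball_self hr
  have gb : ∀ z ∈ ball z0 r, ∀ w ∈ ball w0 r, ‖g (z, w)‖ ≤ 4 * M := by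
    intro z hz w hw
    have e1 := hb z hz w hw
    have e2 := hb z0 hz0 w hw
    have e3 := hb z hz w0 hw0
    have e4 := hb z0 hz0 w0 hw0
    have := norm_sub_le (f z w - f z0 w) (f z w0 - f z0 w0)
    have := norm_sub_le (f z w) (f z0 w)
    have := norm_sub_le (f z w0) (f z0 w0)
    simp only [hg]
    linarith
  have gb1 : ∀ z ∈ ball z0 r, ∀ w ∈ ball w0 r, ‖g (z, w)‖ ≤ 4 * M / r * dist w w0 := by
    intro z hz w hw
    have := Complex.dist_le_div_mul_dist_of_mapsTo_ball (f := fun w => g (z, w)) (c := w0)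
      (R₁ := r) (R₂ := 4 * M) (z := w) ?_ ?_ hw
    · simpa [hg] using this
    · apply Differentiable.differentiableOn
      have := h2 z
      have := h2 z0
      simp only [hg]
      fun_prop
    · intro w' hw'
      have := gb z hz w' hw'
      simpa [hg] using this
  have gb2 : ∀ z ∈ ball z0 r, ∀ w ∈ ball w0 r,
      ‖g (z, w)‖ ≤ 4 * M / r * dist w w0 / r * dist z z0 := by
    intro z hz w hw
    have := Complex.dist_le_div_mul_dist_of_mapsTo_ball (f := fun z => g (z, w)) (c := z0)
      (R₁ := r) (R₂ := 4 * M / r * dist w w0) (z := z) ?_ ?_ hz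
    · simpa [hg] using this
    · apply Differentiable.differentiableOn
      have := h1 w
      have := h1 w0
      simp only [hg]
      fun_prop
    · intro z' hz'
      have := gb1 z' hz' w hw
      simpa [hg] using this
  have hM : 0 ≤ M := (norm_nonneg _).trans (hb z0 hz0 w0 hw0)
  have gd : HasFDerivAt g (0 : E × ℂ →L[ℂ] ℂ) (z0, w0) := by
    apply HasFDerivAt.of_isLittleO
    have : (fun q : E × ℂ => g q - g (z0, w0) - (0 : E × ℂ →L[ℂ] ℂ) (q - (z0, w0)))
        =O[𝓝 (z0, w0)] fun q => ‖q - (z0, w0)‖ ^ 2 := by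
      apply Asymptotics.IsBigO.of_bound (4 * M / r / r)
      filter_upwards [ball_mem_nhds (z0, w0) hr] with q hq
      rw [mem_ball, Prod.dist_eq] at hq
      simp only at hq
      have q1 : dist q.1 z0 < r := lt_of_le_of_lt (le_max_left _ _) hq
      have q2 : dist q.2 w0 < r := lt_of_le_of_lt (le_max_right _ _) hq
      have := gb2 q.1 q1 q.2 q2
      have g0 : g (z0, w0) = 0 := by simp [hg]
      have n1 : dist q.1 z0 ≤ ‖q - (z0, w0)‖ := by
        rw [dist_eq_norm]; exact norm_fst_le (q - (z0, w0))
      have n2 : dist q.2 w0 ≤ ‖q - (z0, w0)‖ := by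
        rw [dist_eq_norm]; exact norm_snd_le (q - (z0, w0))
      rw [g0]
      simp only [sub_zero, zero_apply, norm_pow, norm_norm]
      calc _ ≤ 4 * M / r * dist q.2 w0 / r * dist q.1 z0 := this
        _ = 4 * M / r / r * (dist q.2 w0 * dist q.1 z0) := by ring
        _ ≤ 4 * M / r / r * (‖q - (z0, w0)‖ * ‖q - (z0, w0)‖) := by gcongr
        _ = _ := by ring
    refine this.trans_isLittleO ?_
    have := (Asymptotics.isLittleO_norm_pow_id (E' := E × ℂ) (n := 2) (by norm_num))
    exact this.comp_tendsto (by
      have : Tendsto (fun q : E × ℂ => q - (z0, w0)) (𝓝 (z0, w0)) (𝓝 ((z0, w0) - (z0, w0))) :=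
        (continuous_id.sub continuous_const).tendsto _
      simpa using this)
  have e : (fun q : E × ℂ => f q.1 q.2)
      = fun q => g q + f z0 q.2 + (f q.1 w0 - f z0 w0) := by
    ext q; simp only [hg]; ring
  rw [e]
  have a1 : DifferentiableAt ℂ (fun q : E × ℂ => f z0 q.2) (z0, w0) :=
    ((h2 z0).comp differentiable_snd) _
  have a2 : DifferentiableAt ℂ (fun q : E × ℂ => f q.1 w0) (z0, w0) :=
    ((h1 w0).comp differentiable_fst) _
  exact (gd.differentiableAt.add a1).add (a2.sub_const _)

/-- Taylor coefficients in the first variable depend holomorphically on the second. -/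
lemma coeff_holo (g : ℂ → ℂ → ℂ) (h1 : ∀ w, Differentiable ℂ (fun l => g l w))
    (h2 : ∀ l, Differentiable ℂ (g l)) (d M R : ℝ) (hd : 0 < d)
    (hb : ∀ l, ‖l‖ ≤ d → ∀ w ∈ closedBall (0 : ℂ) R, ‖g l w‖ ≤ M) (k : ℕ) :
    DifferentiableOn ℂ (fun w => iteratedDeriv k (fun l => g l w) 0) (ball 0 R) := by
  have e : (fun w => iteratedDeriv k (fun l => g l w) 0) = fun w =>
      (2 * Real.pi * Complex.I / k.factorial)⁻¹ * ∫ θ in (0:ℝ)..2 * Real.pi,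
        deriv (circleMap 0 d) θ * ((1 / (circleMap 0 d θ - 0) ^ (k + 1)) *
          g (circleMap 0 d θ) w) := by
    ext w
    have := ((h1 w).differentiableOn (s := closedBall 0 d)).circleIntegral_one_div_sub_center_pow_smul
      hd k
    have hne : (2 * Real.pi * Complex.I / k.factorial : ℂ) ≠ 0 := by
      simp [Nat.factorial_ne_zero]
    rw [eq_inv_mul_iff_mul_eq₀ hne]
    simp only [circleIntegral, smul_eq_mul] at this
    rw [← this]
  rw [e]
  apply DifferentiableOn.const_mul
  intro w0 hw0
  apply DifferentiableAt.differentiableWithinAt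
  obtain ⟨r, hr, hrs⟩ : ∃ r > 0, ∀ w ∈ ball w0 r, closedBall w r ⊆ ball 0 R := by
    refine ⟨(R - ‖w0‖) / 3, ?_, ?_⟩
    · have : ‖w0‖ < R := by simpa using hw0
      linarith
    · have : ‖w0‖ < R := by simpa using hw0
      intro w hw y hy
      rw [mem_ball, dist_eq_norm] at hw
      rw [mem_closedBall, dist_eq_norm] at hy
      rw [mem_ball_zero_iff]
      have := norm_le_norm_add_norm_sub w y
      have := norm_le_norm_add_norm_sub w0 w
      rw [norm_sub_rev] at hw hy
      have : ‖y‖ ≤ ‖w‖ + ‖w - y‖ := by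
        have := norm_sub_le w (w - y); simpa using this
      have : ‖w‖ ≤ ‖w0‖ + ‖w0 - w‖ := by
        have := norm_sub_le w0 (w0 - w); simpa using this
      linarith
  set K : ℝ → ℂ := fun θ => deriv (circleMap 0 d) θ * (1 / (circleMap 0 d θ - 0) ^ (k + 1)) with hK
  have hKc : Continuous K := by
    have hne : ∀ θ : ℝ, (circleMap 0 d θ - 0) ^ (k + 1) ≠ 0 := by
      intro θ; simp [hd.ne']
    simp only [hK, deriv_circleMap]
    apply Continuous.mul (by fun_prop)
    exact Continuous.div (by fun_prop) (by fun_prop) hne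
  have hFc : ∀ w, Continuous fun θ => K θ * g (circleMap 0 d θ) w := fun w =>
    hKc.mul ((h1 w).continuous.comp (continuous_circleMap 0 d))
  have main := intervalIntegral.hasDerivAt_integral_of_dominated_loc_of_deriv_le
    (μ := volume) (a := 0) (b := 2 * Real.pi)
    (F := fun w θ => K θ * g (circleMap 0 d θ) w)
    (F' := fun w θ => K θ * deriv (g (circleMap 0 d θ)) w) (x₀ := w0) (s := ball w0 r)
    (bound := fun θ => ‖K θ‖ * (M / r))
    (ball_mem_nhds _ hr) (Eventually.of_forall fun w => (hFc w).aestronglyMeasurable)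
    ((hFc w0).intervalIntegrable _ _) ?_ ?_ ?_ ?_
  · have := main.2.differentiableAt
    simpa only [hK, mul_assoc] using this
  · apply AEStronglyMeasurable.mul hKc.aestronglyMeasurable
    have hseq : Tendsto (fun n : ℕ => w0 + ((1 / ((n : ℝ) + 1) : ℝ) : ℂ)) atTop (𝓝[≠] w0) := by
      apply tendsto_nhdsWithin_iff.2 ⟨?_, ?_⟩
      · have := (Complex.continuous_ofReal.tendsto 0).comp tendsto_one_div_add_atTop_nhds_zero_nat
        simpa using this.const_add w0
      · refine Eventually.of_forall fun n => ?_
        have : (n : ℂ) + 1 ≠ 0 := by exact_mod_cast n.succ_ne_zero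
        simp [this]
    refine aestronglyMeasurable_of_tendsto_ae atTop
      (f := fun (n : ℕ) θ => slope (g (circleMap 0 d θ)) w0 (w0 + ((1 / ((n : ℝ) + 1) : ℝ) : ℂ))) ?_ ?_
    · intro n
      apply Continuous.aestronglyMeasurable
      simp only [slope, vsub_eq_sub]
      have c1 := fun w => (h1 w).continuous.comp (continuous_circleMap 0 d)
      simp only [Function.comp_def] at c1
      simp only [smul_eq_mul]
      exact continuous_const.mul ((c1 _).sub (c1 _))
    · refine Eventually.of_forall fun θ => ?_
      exact ((hasDerivAt_iff_tendsto_slope.1 (h2 (circleMap 0 d θ) w0).hasDerivAt)).comp hseq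
  · refine Eventually.of_forall fun θ _ w hw => ?_
    rw [norm_mul]
    gcongr
    apply Complex.norm_deriv_le_of_forall_mem_sphere_norm_le hr (h2 _).diffContOnCl
    intro y hy
    exact hb _ (by simp [abs_of_pos hd]) y
      (ball_subset_closedBall (hrs w hw (sphere_subset_closedBall hy)))
  · exact (hKc.norm.mul continuous_const).intervalIntegrable _ _
  · refine Eventually.of_forall fun θ _ w _ => ?_
    exact ((h2 _ w).hasDerivAt).const_mul _

/-- Two constants estimate from the Jensen formula. -/
lemma two_const (c : ℂ → ℂ) (w : ℂ) (r a b τ : ℝ) (hr : 0 < r)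
    (hc : AnalyticOnNhd ℂ c (closedBall w r)) (B : Set ℂ) (hB : MeasurableSet B)
    (hab : a ≤ b) (h1 : ∀ y ∈ sphere w r, ‖c y‖ ≤ Real.exp b)
    (h2 : ∀ y ∈ sphere w r, y ∉ B → ‖c y‖ ≤ Real.exp a) (hτ : 0 ≤ τ)
    (hm : volume ({θ : ℝ | circleMap w r θ ∈ B} ∩ Ioc (-Real.pi) Real.pi)
      ≤ ENNReal.ofReal (2 * Real.pi * τ)) :
    ‖c w‖ ≤ Real.exp (a + (b - a) * τ) := by
  by_cases h0 : c w = 0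
  · rw [h0, norm_zero]; positivity
  rw [← Real.log_le_iff_le_exp (norm_pos_iff.2 h0)]
  have habs : |r| = r := abs_of_pos hr
  have hJ : Real.log ‖c w‖ ≤ Real.circleAverage (fun y => Real.log ‖c y‖) w r := by
    rw [AnalyticOnNhd.circleAverage_log_norm hr.ne' (by rwa [habs]) h0]
    have : 0 ≤ ∑ᶠ u, (MeromorphicOn.divisor c (closedBall w |r|) u : ℝ)
        * Real.log (r * ‖w - u‖⁻¹) := by
      apply finsum_nonneg
      intro u
      rw [habs]
      by_cases hu : u ∈ closedBall w r
      · apply mul_nonneg (mod_cast MeromorphicOn.AnalyticOnNhd.divisor_nonneg hc u)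
        rcases eq_or_ne u w with rfl | hne
        · simp
        · apply Real.log_nonneg
          have : 0 < ‖w - u‖ := norm_pos_iff.2 (sub_ne_zero.2 hne.symm)
          rw [← div_eq_mul_inv, one_le_div this]
          simpa [dist_eq_norm, norm_sub_rev] using hu
      · simp [hu]
    linarith
  refine hJ.trans ?_
  have hav : Real.circleAverage (fun y => Real.log ‖c y‖) w r
      = (2 * Real.pi)⁻¹ * ∫ θ in Ioc (-Real.pi) Real.pi, Real.log ‖c (circleMap w r θ)‖ := by
    rw [Real.circleAverage_eq_integral_add (-Real.pi),
      intervalIntegral.integral_comp_add_right (fun θ => Real.log ‖c (circleMap w r θ)‖),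
      intervalIntegral.integral_of_le (by linarith [Real.pi_pos])]
    simp only [smul_eq_mul, zero_add]
    congr 4
    ring
  have hint : IntegrableOn (fun θ => Real.log ‖c (circleMap w r θ)‖)
      (Ioc (-Real.pi) Real.pi) := by
    have : CircleIntegrable (fun y => Real.log ‖c y‖) w r :=
      MeromorphicOn.circleIntegrable_log_norm
        (by rw [habs]; exact (hc.mono sphere_subset_closedBall).meromorphicOn)
    have hp : (fun θ => Real.log ‖c (circleMap w r θ)‖).Periodic (2 * Real.pi) :=
      fun x => by simp [periodic_circleMap w r x]
    have := hp.intervalIntegrable₀ (by positivity) this (-Real.pi) Real.pi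
    rwa [intervalIntegrable_iff_integrableOn_Ioc_of_le (by linarith [Real.pi_pos])] at this
  set S : Set ℝ := {θ : ℝ | circleMap w r θ ∈ B} with hS
  have hSm : MeasurableSet S := (continuous_circleMap w r).measurable hB
  have hae : ∀ᵐ θ ∂(volume.restrict (Ioc (-Real.pi) Real.pi)), c (circleMap w r θ) ≠ 0 := by
    have hcod : c ⁻¹' {0}ᶜ ∈ codiscreteWithin (closedBall w r) :=
      hc.preimage_zero_mem_codiscreteWithin h0 (mem_closedBall_self hr.le)
        ((convex_closedBall w r).isConnected ⟨w, mem_closedBall_self hr.le⟩)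
    have h3 : c ⁻¹' {0}ᶜ ∈ codiscreteWithin (sphere w |r|) := by
      rw [habs]; exact codiscreteWithin_mono sphere_subset_closedBall hcod
    have h4 := circleMap_preimage_codiscrete hr.ne' h3
    have h5 := ae_restrict_le_codiscreteWithin (μ := volume)
      (measurableSet_Ioc (a := -Real.pi) (b := Real.pi))
      (codiscreteWithin_mono (subset_univ _) h4)
    exact h5
  have hle : ∫ θ in Ioc (-Real.pi) Real.pi, Real.log ‖c (circleMap w r θ)‖
      ≤ ∫ θ in Ioc (-Real.pi) Real.pi, (a + S.indicator (fun _ => b - a) θ) := by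
    apply integral_mono_ae hint
    · apply Integrable.add (integrable_const _)
      exact (integrable_const _).indicator hSm
    · filter_upwards [hae] with θ hθ
      rw [Real.log_le_iff_le_exp (norm_pos_iff.2 hθ)]
      have hsp : circleMap w r θ ∈ sphere w r := circleMap_mem_sphere _ hr.le _
      by_cases hθS : θ ∈ S
      · simp only [hθS, indicator_of_mem]
        simpa using h1 _ hsp
      · simp only [hθS, not_false_eq_true, indicator_of_notMem, add_zero]
        exact h2 _ hsp hθS
  have hval : ∫ θ in Ioc (-Real.pi) Real.pi, (a + S.indicator (fun _ => b - a) θ)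
      ≤ 2 * Real.pi * a + 2 * Real.pi * τ * (b - a) := by
    rw [integral_add (integrable_const _) ((integrable_const _).indicator hSm),
      integral_indicator hSm, setIntegral_const, setIntegral_const]
    simp only [smul_eq_mul]
    have v1 : volume.real (Ioc (-Real.pi) Real.pi) = 2 * Real.pi := by
      rw [Real.volume_real_Ioc_of_le (by linarith [Real.pi_pos])]; ring
    have v2 : (volume.restrict (Ioc (-Real.pi) Real.pi)).real S ≤ 2 * Real.pi * τ := by
      rw [measureReal_restrict_apply hSm]
      exact ENNReal.toReal_le_of_le_ofReal (by positivity) hm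
    rw [v1]
    have : 0 ≤ b - a := by linarith
    gcongr
  rw [hav]
  calc _ ≤ (2 * Real.pi)⁻¹ * (2 * Real.pi * a + 2 * Real.pi * τ * (b - a)) := by
        gcongr; exact hle.trans hval
    _ = _ := by
        have := Real.pi_ne_zero
        field_simp

lemma polar_slice (B : Set ℂ) (hB : MeasurableSet B) (w : ℂ) (s η : ℝ) (hs : 0 < s) (hη : 0 < η)
    (h : volume B < ENNReal.ofReal (η * s ^ 2 / 4)) :
    ∃ r ∈ Ioo (s / 2) s, volume ({θ : ℝ | circleMap w r θ ∈ B} ∩ Ioc (-Real.pi) Real.pi)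
      ≤ ENNReal.ofReal η := by
  by_contra hcon
  push Not at hcon
  apply absurd h
  rw [not_lt]
  set J : Set ℝ := Ioo (-Real.pi) Real.pi
  set I : Set ℝ := Ioo (s / 2) s
  set B' : Set ℂ := (fun y => w + y) ⁻¹' B with hB'
  have hB'm : MeasurableSet B' := (measurable_const_add w) hB
  have e1 : volume B = ∫⁻ y, B'.indicator 1 y := by
    rw [lintegral_indicator_one hB'm, hB', measure_preimage_add]
  have hcm : Measurable fun q : ℝ × ℝ => circleMap w q.1 q.2 := by
    unfold circleMap; fun_prop
  set T : Set (ℝ × ℝ) := (fun q : ℝ × ℝ => circleMap w q.1 q.2) ⁻¹' B with hT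
  have hTm : MeasurableSet T := hcm hB
  rw [e1, ← Complex.lintegral_comp_polarCoord_symm]
  calc ENNReal.ofReal (η * s ^ 2 / 4)
      = ENNReal.ofReal (s / 2) * (ENNReal.ofReal η * ENNReal.ofReal (s / 2)) := by
        rw [← ENNReal.ofReal_mul hη.le, ← ENNReal.ofReal_mul (by positivity)]
        congr 1; ring
    _ = ENNReal.ofReal (s / 2) * ∫⁻ r in I, ENNReal.ofReal η := by
        rw [setLIntegral_const, Real.volume_Ioo]
        congr 4; ring
    _ ≤ ENNReal.ofReal (s / 2) * ∫⁻ r in I, (volume.restrict J) {θ | (r, θ) ∈ T} := by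
        refine mul_le_mul_right ?_ _
        apply setLIntegral_mono' measurableSet_Ioo
        intro r hr
        have := (hcon r hr).le
        rwa [Measure.restrict_congr_set (Ioo_ae_eq_Ioc (μ := volume)),
          Measure.restrict_apply' measurableSet_Ioc]
    _ = ENNReal.ofReal (s / 2) * ((volume.restrict I).prod (volume.restrict J)) T := by
        rw [Measure.prod_apply hTm]; rfl
    _ = ∫⁻ q in I ×ˢ J, ENNReal.ofReal (s / 2) * T.indicator 1 q := by
        rw [lintegral_const_mul _ (measurable_one.indicator hTm), lintegral_indicator_one hTm,
          Measure.prod_restrict, Measure.volume_eq_prod]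
    _ ≤ ∫⁻ q in I ×ˢ J, ENNReal.ofReal q.1 • B'.indicator 1 (Complex.polarCoord.symm q) := by
        apply setLIntegral_mono' (measurableSet_Ioo.prod measurableSet_Ioo)
        intro q hq
        rw [smul_eq_mul]
        gcongr ?_ * ?_
        · exact ENNReal.ofReal_le_ofReal hq.1.1.le
        · apply le_of_eq
          have : q ∈ T ↔ Complex.polarCoord.symm q ∈ B' := by
            simp only [hT, hB', mem_preimage, Complex.polarCoord_symm_apply, circleMap,
              Complex.exp_mul_I, Complex.ofReal_cos, Complex.ofReal_sin]
          by_cases hq : q ∈ T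
          · rw [indicator_of_mem hq, indicator_of_mem (this.1 hq)]; rfl
          · rw [indicator_of_notMem hq, indicator_of_notMem (fun h => hq (this.2 h))]
    _ ≤ _ := by
        apply lintegral_mono_set
        rintro q ⟨h1, h2⟩
        refine ⟨?_, h2⟩
        exact (half_pos hs).trans h1.1

lemma hartogs_locally_bounded {E : Type*} [NormedAddCommGroup E] [NormedSpace ℂ E]
    [FiniteDimensional ℂ E] (f : E → ℂ → ℂ)
    (h1 : ∀ w, Differentiable ℂ (fun z => f z w)) (h2 : ∀ z, Differentiable ℂ (f z))
    (z1 : E) (w1 : ℂ) :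
    ∃ K : ℝ, ∀ z ∈ ball z1 1, ∀ w ∈ ball w1 1, ‖f z w‖ ≤ K := by
  have : ProperSpace E := FiniteDimensional.proper ℂ E
  have : CompleteSpace E := FiniteDimensional.complete ℂ E
  -- the radius in the second variable
  set R : ℝ := 2 * (‖w1‖ + 1) with hR
  have hRpos : 0 < R := by positivity
  -- Baire category step
  obtain ⟨z0, d, M, hd, hd1, hM, hbd⟩ : ∃ (z0 : E) (d M : ℝ), 0 < d ∧ d < 1 ∧ 1 ≤ M ∧
      ∀ z ∈ closedBall z0 d, ∀ w ∈ closedBall (0 : ℂ) R, ‖f z w‖ ≤ M := by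
    have hcl : ∀ n : ℕ, IsClosed {z : E | ∀ w ∈ closedBall (0 : ℂ) R, ‖f z w‖ ≤ n} := by
      intro n
      simp only [ofPred_forall]
      refine isClosed_iInter fun w => isClosed_iInter fun _ => ?_
      exact isClosed_le (h1 w).continuous.norm continuous_const
    have hun : (⋃ n : ℕ, {z : E | ∀ w ∈ closedBall (0 : ℂ) R, ‖f z w‖ ≤ n}) = univ := by
      refine eq_univ_of_forall fun z => ?_
      obtain ⟨C, hC⟩ := (isCompact_closedBall (0 : ℂ) R).exists_bound_of_continuousOn
        (h2 z).continuous.continuousOn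
      obtain ⟨n, hn⟩ := exists_nat_ge C
      exact mem_iUnion.2 ⟨n, fun w hw => (hC w hw).trans hn⟩
    obtain ⟨n, z0, hz0⟩ := nonempty_interior_of_iUnion_of_closed hcl hun
    obtain ⟨e, he, hes⟩ := Metric.isOpen_iff.1 isOpen_interior z0 hz0
    refine ⟨z0, min (e / 2) (1 / 2), n + 1, by positivity, ?_, by simp, ?_⟩
    · exact (min_le_right _ _).trans_lt (by norm_num)
    · intro z hz w hw
      have : z ∈ ball z0 e := by
        rw [mem_ball]
        rw [mem_closedBall] at hz
        have := min_le_left (e / 2) (1 / 2)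
        linarith
      have : ‖f z w‖ ≤ n := interior_subset (hes this) w hw
      linarith
  -- the target radius in the first variable
  set A : ℝ := ‖z1 - z0‖ + 2 with hA
  have hA1 : 1 < A := by have := norm_nonneg (z1 - z0); linarith
  have hA0 : 0 < A := by linarith
  have hlA : 0 < Real.log A := Real.log_pos hA1
  have hld : 0 < -Real.log d := by have := Real.log_neg hd hd1; linarith
  set τ : ℝ := Real.log A / (2 * Real.log A - Real.log d) with hτ
  have hden : 0 < 2 * Real.log A - Real.log d := by linarith
  have hτ0 : 0 < τ := div_pos hlA hden
  -- good set
  set G : ℕ → Set ℂ := fun n => {w | ∀ z ∈ closedBall z0 (A ^ 2), ‖f z w‖ ≤ n} with hG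
  have hGcl : ∀ n, IsClosed (G n) := by
    intro n
    simp only [hG, ofPred_forall]
    refine isClosed_iInter fun z => isClosed_iInter fun _ => ?_
    exact isClosed_le (h2 z).continuous.norm continuous_const
  set Bd : ℕ → Set ℂ := fun n => closedBall 0 R \ G n with hBd
  have hBdm : ∀ n, MeasurableSet (Bd n) := fun n =>
    measurableSet_closedBall.diff (hGcl n).measurableSet
  have hlim : Tendsto (volume ∘ Bd) atTop (𝓝 (volume (⋂ n, Bd n))) := by
    apply tendsto_measure_iInter_atTop (fun n => (hBdm n).nullMeasurableSet)
    · intro m n hmn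
      apply sdiff_subset_sdiff_right
      intro w hw z hz
      have : (m : ℝ) ≤ n := by exact_mod_cast hmn
      exact (hw z hz).trans this
    · exact ⟨0, ((measure_mono sdiff_subset).trans_lt measure_closedBall_lt_top).ne⟩
  have hemp : (⋂ n, Bd n) = ∅ := by
    refine eq_empty_of_forall_notMem fun w hw => ?_
    obtain ⟨C, hC⟩ := (isCompact_closedBall z0 (A ^ 2)).exists_bound_of_continuousOn
        (h1 w).continuous.continuousOn
    obtain ⟨n, hn⟩ := exists_nat_ge C
    exact (mem_iInter.1 hw n).2 fun z hz => (hC z hz).trans hn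
  rw [hemp, measure_empty] at hlim
  have hη : 0 < 2 * Real.pi * τ := by positivity
  have hev := hlim.eventually_lt_const
    (show (0 : ENNReal) < ENNReal.ofReal (2 * Real.pi * τ * (R / 2) ^ 2 / 4) by
      rw [ENNReal.ofReal_pos]; positivity)
  obtain ⟨n, hn⟩ := hev.exists
  simp only [Function.comp] at hn
  set K : ℝ := max n M with hK
  have hK1 : 1 ≤ K := hM.trans (le_max_right _ _)
  have hK0 : 0 < K := by linarith
  -- coefficient estimate
  have hcoef : ∀ v : E, ‖v‖ ≤ 1 → ∀ w ∈ ball (0 : ℂ) (R / 2), ∀ k : ℕ,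
      ‖(k.factorial : ℂ)⁻¹ * iteratedDeriv k (fun l : ℂ => f (z0 + l • v) w) 0‖ ≤ K / A ^ k := by
    intro v hv w hw k
    have g1 : ∀ w, Differentiable ℂ (fun l : ℂ => f (z0 + l • v) w) := fun w =>
      (h1 w).comp (by fun_prop)
    have hcb : ∀ (ρ C : ℝ), 0 < ρ → ∀ y, (∀ z ∈ closedBall z0 ρ, ‖f z y‖ ≤ C) →
        ‖(k.factorial : ℂ)⁻¹ * iteratedDeriv k (fun l : ℂ => f (z0 + l • v) y) 0‖ ≤ C / ρ ^ k := by
      intro ρ C hρ y hy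
      have := Complex.norm_iteratedDeriv_le_of_forall_mem_sphere_norm_le k hρ
        (g1 y).diffContOnCl (c := 0) (C := C) (by
          intro l hl
          apply hy
          rw [mem_closedBall, dist_eq_norm, add_sub_cancel_left, norm_smul]
          rw [mem_sphere_zero_iff_norm] at hl
          rw [hl]
          exact mul_le_of_le_one_right hρ.le hv)
      rw [norm_mul, norm_inv, Complex.norm_natCast, inv_mul_le_iff₀ (by positivity)]
      rw [mul_div_assoc] at this
      exact this
    set c : ℂ → ℂ := fun y =>
      (k.factorial : ℂ)⁻¹ * iteratedDeriv k (fun l : ℂ => f (z0 + l • v) y) 0 with hc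
    have hdiff : DifferentiableOn ℂ c (ball 0 R) := by
      apply DifferentiableOn.const_mul
      apply coeff_holo (fun l w => f (z0 + l • v) w) g1 (fun l => h2 _) d M R hd
      intro l hl y hy
      apply hbd _ _ y hy
      rw [mem_closedBall, dist_eq_norm, add_sub_cancel_left, norm_smul]
      calc ‖l‖ * ‖v‖ ≤ d * 1 := by gcongr
        _ = d := mul_one d
    obtain ⟨r, hr, hrm⟩ := polar_slice (Bd n) (hBdm n) w (R / 2) (2 * Real.pi * τ)
      (by positivity) hη hn
    have hr0 : 0 < r := by have := hr.1; linarith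
    have hsub : closedBall w r ⊆ ball 0 R := by
      intro y hy
      rw [mem_closedBall] at hy
      rw [mem_ball] at hw ⊢
      have := dist_triangle y w 0
      have := hr.2
      linarith
    have han : AnalyticOnNhd ℂ c (closedBall w r) :=
      (hdiff.analyticOnNhd isOpen_ball).mono hsub
    have hmono : Real.log K - k * (2 * Real.log A) ≤ Real.log K - k * Real.log d := by
      have : (0 : ℝ) ≤ k := Nat.cast_nonneg k
      nlinarith
    have hexp : ∀ x : ℝ, 0 < x → K / x ^ k = Real.exp (Real.log K - k * Real.log x) := by
      intro x hx
      rw [Real.exp_sub, Real.exp_log hK0, Real.exp_nat_mul, Real.exp_log hx]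
    have key := two_const c w r (Real.log K - k * (2 * Real.log A)) (Real.log K - k * Real.log d) τ
      hr0 han (Bd n) (hBdm n) hmono ?_ ?_ hτ0.le hrm
    · rw [hexp A hA0]
      convert key using 2
      have hτm : τ * (2 * Real.log A - Real.log d) = Real.log A := div_mul_cancel₀ _ hden.ne'
      linear_combination (-(k : ℝ)) * hτm
    · intro y hy
      have hy' := ball_subset_closedBall (hsub (sphere_subset_closedBall hy))
      rw [← hexp d hd]
      exact (hcb d M hd y (fun z hz => hbd z hz y hy')).trans (by gcongr; exact le_max_right _ _)
    · intro y hy hyB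
      have hy' := ball_subset_closedBall (hsub (sphere_subset_closedBall hy))
      have hyG : y ∈ G n := by
        by_contra hcon
        exact hyB ⟨hy', hcon⟩
      have e : Real.log K - k * (2 * Real.log A) = Real.log K - k * Real.log (A ^ 2) := by
        rw [Real.log_pow]; norm_num
      rw [e, ← hexp (A ^ 2) (by positivity)]
      exact (hcb (A ^ 2) n (by positivity) y hyG).trans (by gcongr; exact le_max_left _ _)
  -- conclusion
  set ρ : ℝ := A - 1 with hρ
  have hρ0 : 0 < ρ := by linarith
  refine ⟨K * (1 - ρ / A)⁻¹, fun z hz w hw => ?_⟩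
  have hz' : ‖z - z0‖ ≤ ρ := by
    rw [mem_ball, dist_eq_norm] at hz
    have := norm_add_le (z - z1) (z1 - z0)
    rw [sub_add_sub_cancel] at this
    linarith
  have hw' : w ∈ ball (0 : ℂ) (R / 2) := by
    rw [mem_ball, dist_eq_norm] at hw
    rw [mem_ball_zero_iff]
    have := norm_add_le (w - w1) w1
    rw [sub_add_cancel] at this
    linarith
  set v : E := (ρ : ℂ)⁻¹ • (z - z0) with hv
  have hρc : (ρ : ℂ) ≠ 0 := by exact_mod_cast hρ0.ne'
  have hv1 : ‖v‖ ≤ 1 := by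
    rw [hv, norm_smul, norm_inv, Complex.norm_real, Real.norm_of_nonneg hρ0.le,
      inv_mul_le_iff₀ hρ0]
    linarith
  have hzv : z0 + (ρ : ℂ) • v = z := by
    rw [hv, smul_inv_smul₀ hρc]; abel
  have hsum := Complex.hasSum_taylorSeries_of_entire
    (f := fun l : ℂ => f (z0 + l • v) w) ((h1 w).comp (by fun_prop)) 0 (ρ : ℂ)
  simp only [hzv] at hsum
  have hq1 : ρ / A < 1 := by rw [div_lt_one hA0]; linarith
  have hgeo := (hasSum_geometric_of_lt_one (r := ρ / A) (by positivity) hq1).mul_left K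
  rw [← hsum.tsum_eq]
  apply tsum_of_norm_bounded hgeo
  intro k
  have := hcoef v hv1 w hw' k
  calc _ = ρ ^ k * ‖(k.factorial : ℂ)⁻¹ *
        iteratedDeriv k (fun l : ℂ => f (z0 + l • v) w) 0‖ := by
        simp only [sub_zero, smul_eq_mul, norm_mul, norm_pow, Complex.norm_real,
          Real.norm_of_nonneg hρ0.le]
        ring
    _ ≤ ρ ^ k * (K / A ^ k) := by gcongr
    _ = K * (ρ / A) ^ k := by rw [div_pow]; ring

lemma hartogs_prod {E : Type*} [NormedAddCommGroup E] [NormedSpace ℂ E]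
    [FiniteDimensional ℂ E] (f : E → ℂ → ℂ)
    (h1 : ∀ w, Differentiable ℂ (fun z => f z w)) (h2 : ∀ z, Differentiable ℂ (f z)) :
    Differentiable ℂ (fun q : E × ℂ => f q.1 q.2) := by
  rintro ⟨z, w⟩
  obtain ⟨K, hK⟩ := hartogs_locally_bounded f h1 h2 z w
  exact osgood_at f h1 h2 z w 1 K one_pos hK

/-- The Hartogs theorem for entire functions on `ℂ^n`. -/
lemma hartogs_pi (n : ℕ) : ∀ f : (Fin n → ℂ) → ℂ,
    (∀ (x : Fin n → ℂ) (i : Fin n),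
      DifferentiableAt ℂ (fun w => f (Function.update x i w)) (x i)) → Differentiable ℂ f := by
  induction n with
  | zero =>
    intro f _
    have : f = fun _ => f 0 := by ext x; rw [Subsingleton.elim x 0]
    rw [this]
    exact differentiable_const _
  | succ n ih =>
    intro f hf
    have key := hartogs_prod (fun (z : Fin n → ℂ) (w : ℂ) => f (Fin.cons w z)) ?_ ?_
    · have e : f = (fun q : (Fin n → ℂ) × ℂ => f (Fin.cons q.2 q.1)) ∘
          fun x : Fin (n + 1) → ℂ => (Fin.tail x, x 0) := by
        ext x; simp
      rw [e]
      refine key.comp ?_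
      unfold Fin.tail
      fun_prop
    · intro w
      apply ih
      intro x i
      have := hf (Fin.cons w x) i.succ
      simpa [← Fin.cons_update] using this
    · intro z w
      have := hf (Fin.cons w z) 0
      simpa using this

end Hartogs


/-- Addendum ansatz: if `Ψ(z,x)` satisfies
`(1/2)∂²Ψ/∂z² = Σ_j p_{j+1}(x) ∂Ψ/∂x_j + ρ(x)Ψ` and `x(t)` solves
`x_j' = p_{j+1}(x)` with `r' = ρ(x)`, then `ψ(z,t) = e^{r(t)} Ψ(z,x(t))`
solves the heat equation. Here `i : Fin (n+1)` stands for `j = i + 1`, so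
`x i = x_{i+1}` and `p i = p_{i+2}`. -/
theorem addendum_heat_solution
    (n : ℕ)
    (p : Fin (n + 1) → (Fin (n + 1) → ℂ) → ℂ) (ρ : (Fin (n + 1) → ℂ) → ℂ)
    (hpoly : ∀ i, ∃ P : MvPolynomial (Fin (n + 1)) ℂ, ∀ x, p i x = MvPolynomial.eval x P)
    (hρpoly : ∃ P : MvPolynomial (Fin (n + 1)) ℂ, ∀ x, ρ x = MvPolynomial.eval x P)
    (Ψ : ℂ → (Fin (n + 1) → ℂ) → ℂ)
    (hΨx : ∀ (z : ℂ) (x : Fin (n + 1) → ℂ) (i : Fin (n + 1)),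
      DifferentiableAt ℂ (fun w => Ψ z (Function.update x i w)) (x i))
    (hΨz : ∀ (z : ℂ) (x : Fin (n + 1) → ℂ), DifferentiableAt ℂ (fun w => Ψ w x) z ∧
      DifferentiableAt ℂ (deriv fun w => Ψ w x) z)
    (hPDE : ∀ (z : ℂ) (x : Fin (n + 1) → ℂ),
      (1 / 2) * deriv (deriv fun w => Ψ w x) z =
        (∑ i : Fin (n + 1),
          p i x * deriv (fun w => Ψ z (Function.update x i w)) (x i)) + ρ x * Ψ z x)
    (V : Set ℂ) (hV : IsOpen V)
    (r : ℂ → ℂ) (x : Fin (n + 1) → ℂ → ℂ)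
    (hr : DifferentiableOn ℂ r V) (hx : ∀ i, DifferentiableOn ℂ (x i) V)
    (hsysx : ∀ i, ∀ t ∈ V, deriv (x i) t = p i (fun j => x j t))
    (hsysr : ∀ t ∈ V, deriv r t = ρ (fun j => x j t))
    (ψ : ℂ → ℂ → ℂ)
    (hψ : ∀ z t, ψ z t = Complex.exp (r t) * Ψ z (fun j => x j t)) :
    ∀ z : ℂ, ∀ t ∈ V,
      deriv (fun v => ψ z v) t = (1 / 2) * deriv (deriv fun w => ψ w t) z := by
  intro z t ht
  have hV' := hV.mem_nhds ht
  have hD : Differentiable ℂ (Ψ z) := hartogs_pi (n + 1) (Ψ z) (hΨx z)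
  set X : Fin (n + 1) → ℂ := fun j => x j t with hX
  have hXd : HasDerivAt (fun v => fun j => x j v) (fun j => p j X) t := by
    rw [hasDerivAt_pi]
    intro j
    rw [← hsysx j t ht]
    exact ((hx j).differentiableAt hV').hasDerivAt
  have hrd : HasDerivAt r (ρ X) t := by
    rw [← hsysr t ht]
    exact (hr.differentiableAt hV').hasDerivAt
  have hpart : ∀ i, deriv (fun w => Ψ z (Function.update X i w)) (X i)
      = fderiv ℂ (Ψ z) X (Pi.single i 1) := by
    intro i
    have h := (hD (Function.update X i (X i))).hasFDerivAt.comp_hasDerivAt (X i)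
      (hasDerivAt_update X i (X i))
    rw [Function.update_eq_self] at h
    exact h.deriv
  have hlin : fderiv ℂ (Ψ z) X (fun j => p j X)
      = ∑ i, p i X * deriv (fun w => Ψ z (Function.update X i w)) (X i) := by
    have e : (fun j => p j X) = ∑ i, p i X • (Pi.single i 1 : Fin (n + 1) → ℂ) := by
      ext j
      simp [Finset.sum_apply, Pi.single_apply]
    conv_lhs => rw [e]
    rw [map_sum]
    refine Finset.sum_congr rfl fun i _ => ?_
    rw [map_smul, smul_eq_mul, hpart]
  have hchain : HasDerivAt (fun v => Ψ z (fun j => x j v)) (fderiv ℂ (Ψ z) X (fun j => p j X)) t :=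
    (hD X).hasFDerivAt.comp_hasDerivAt t hXd
  have hleft : HasDerivAt (fun v => ψ z v)
      (Complex.exp (r t) * ρ X * Ψ z X + Complex.exp (r t) *
        fderiv ℂ (Ψ z) X (fun j => p j X)) t := by
    have e : (fun v => ψ z v) = fun v => Complex.exp (r v) * Ψ z (fun j => x j v) := by
      ext v; exact hψ z v
    rw [e]
    exact hrd.cexp.mul hchain
  have hright : deriv (deriv fun w => ψ w t) z
      = Complex.exp (r t) * deriv (deriv fun w => Ψ w X) z := by
    have e : (fun w => ψ w t) = fun w => Complex.exp (r t) * Ψ w X := by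
      ext w; exact hψ w t
    have e2 : deriv (fun w => ψ w t) = fun w => Complex.exp (r t) * deriv (fun w => Ψ w X) w := by
      rw [e]
      ext w
      exact deriv_const_mul _ (hΨz w X).1
    rw [e2]
    exact deriv_const_mul _ (hΨz z X).2
  rw [hleft.deriv, hright, hlin]
  linear_combination (-Complex.exp (r t)) * hPDE z X
end

section
/- Let a₁, a₂, a₃ ∈ ℂ and define x₁(t) = (1/3)(1/(t − a₁) + 1/(t − a₂) + 1/(t − a₃)) on V = ℂ \ {a₁, a₂, a₃}. Then x₁ satisfies x₁''' = −3(4 x₁ x₁'' + 3 (x₁')² + 18 x₁² x₁' + 9 x₁⁴) at every point of V. -/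
theorem aux_hasDerivAt_pow_inv (a t : ℂ) (h : t ≠ a) (n : ℕ) :
    HasDerivAt (fun s : ℂ => ((s - a)⁻¹) ^ (n + 1))
      (-((n : ℂ) + 1) * ((t - a)⁻¹) ^ (n + 2)) t := by
  have h' : t - a ≠ 0 := sub_ne_zero.mpr h
  have h1 := (((hasDerivAt_id t).sub_const a).inv h').pow (n + 1)
  refine HasDerivAt.congr_deriv (f := fun s : ℂ => ((s - a)⁻¹) ^ (n + 1)) h1 ?_
  simp
  field_simp
  ring

theorem aux_deriv_step (a₁ a₂ a₃ c : ℂ) (n : ℕ) (f : ℂ → ℂ)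
    (hf : ∀ t : ℂ, t ≠ a₁ → t ≠ a₂ → t ≠ a₃ → f t =
      c * (((t - a₁)⁻¹) ^ (n + 1) + ((t - a₂)⁻¹) ^ (n + 1) + ((t - a₃)⁻¹) ^ (n + 1))) :
    ∀ t : ℂ, t ≠ a₁ → t ≠ a₂ → t ≠ a₃ → deriv f t =
      (c * -((n : ℂ) + 1)) *
        (((t - a₁)⁻¹) ^ (n + 2) + ((t - a₂)⁻¹) ^ (n + 2) + ((t - a₃)⁻¹) ^ (n + 2)) := by
  intro t h1 h2 h3
  have hd := (((aux_hasDerivAt_pow_inv a₁ t h1 n).add (aux_hasDerivAt_pow_inv a₂ t h2 n)).add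
    (aux_hasDerivAt_pow_inv a₃ t h3 n)).const_mul c
  have he : f =ᶠ[nhds t] fun t =>
      c * (((t - a₁)⁻¹) ^ (n + 1) + ((t - a₂)⁻¹) ^ (n + 1) + ((t - a₃)⁻¹) ^ (n + 1)) := by
    filter_upwards [isOpen_ne.mem_nhds h1, isOpen_ne.mem_nhds h2, isOpen_ne.mem_nhds h3]
      with s k1 k2 k3
    exact hf s k1 k2 k3
  rw [(HasDerivAt.congr_of_eventuallyEq hd he).deriv]
  ring

/-- `x₁(t) = (1/3)(1/(t-a₁) + 1/(t-a₂) + 1/(t-a₃))` satisfies the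
third-order equation `x₁''' = -3(4x₁x₁'' + 3(x₁')² + 18x₁²x₁' + 9x₁⁴)`
arising in the addendum construction for `n = 2`. -/
theorem rational_solution_addendum_case_n_two
    (a₁ a₂ a₃ : ℂ) (x₁ : ℂ → ℂ)
    (hx₁ : ∀ t, x₁ t = (1 / 3) * (1 / (t - a₁) + 1 / (t - a₂) + 1 / (t - a₃))) :
    ∀ t : ℂ, t ≠ a₁ → t ≠ a₂ → t ≠ a₃ →
      deriv (deriv (deriv x₁)) t =
        -3 * (4 * x₁ t * deriv (deriv x₁) t + 3 * (deriv x₁ t) ^ 2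
          + 18 * x₁ t ^ 2 * deriv x₁ t + 9 * x₁ t ^ 4) := by
  have d0 : ∀ t : ℂ, t ≠ a₁ → t ≠ a₂ → t ≠ a₃ → x₁ t = (1 / 3) *
      (((t - a₁)⁻¹) ^ (0 + 1) + ((t - a₂)⁻¹) ^ (0 + 1) + ((t - a₃)⁻¹) ^ (0 + 1)) := by
    intro t _ _ _
    rw [hx₁]
    simp
  have d1 := aux_deriv_step a₁ a₂ a₃ _ 0 _ d0
  have d2 := aux_deriv_step a₁ a₂ a₃ _ 1 _ d1
  have d3 := aux_deriv_step a₁ a₂ a₃ _ 2 _ d2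
  intro t h1 h2 h3
  rw [d3 t h1 h2 h3, d2 t h1 h2 h3, d1 t h1 h2 h3, d0 t h1 h2 h3]
  push_cast
  ring
end
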